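/- The arrangement B₇ = B ∪ {H₁,...,H₇} in 𝔽₁₁³, where B is the 27-hyperplane arrangement of the paper over 𝔽₁₁ and (H₁,...,H₇) = ((0,1,0)^⊥, (1,1,0)^⊥, (1,2,0)^⊥, (1,3,0)^⊥, (1,4,0)^⊥, (1,5,0)^⊥, (1,7,0)^⊥), is inductively free. -/

import Mathlib

open Module Matrix
open scoped Classical

namespace Arrgt

variable {K : Type*} [Field K]

/-- A (central) hyperplane arrangement in `K^n`: a finite set of kernels of
nonzero linear forms. -/
structure Arrangement (K : Type*) [Field K] (n : ℕ) where
  hyperplanes : Finset (Submodule K (Fin n → K))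
  isHyp : ∀ H ∈ hyperplanes, ∃ f : (Fin n → K) →ₗ[K] K, f ≠ 0 ∧ H = LinearMap.ker f

/-- The deletion `A \ {H}`. -/
noncomputable def Arrangement.delete {n : ℕ} (A : Arrangement K n) (H : Submodule K (Fin n → K)) :
    Arrangement K n :=
  ⟨A.hyperplanes.erase H, fun H' hH' => A.isHyp H' (Finset.mem_of_mem_erase hH')⟩

/-- The empty arrangement of rank `n`. -/
def emptyArr (K : Type*) [Field K] (n : ℕ) : Arrangement K n := ⟨∅, by simp⟩

/-- The linear polynomial in `K[x_1,...,x_n]` attached to a linear form. -/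
noncomputable def linPoly {n : ℕ} (f : (Fin n → K) →ₗ[K] K) : MvPolynomial (Fin n) K :=
  ∑ i, MvPolynomial.C (f (Pi.single i 1)) * MvPolynomial.X i

/-- `Q` is a defining polynomial of the arrangement `A`: a product of linear forms
whose kernels are exactly the hyperplanes of `A`. -/
def IsDefiningPoly {n : ℕ} (A : Arrangement K n) (Q : MvPolynomial (Fin n) K) : Prop :=
  ∃ α : Submodule K (Fin n → K) → ((Fin n → K) →ₗ[K] K),
    (∀ H ∈ A.hyperplanes, α H ≠ 0 ∧ LinearMap.ker (α H) = H) ∧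
    Q = ∏ H ∈ A.hyperplanes, linPoly (α H)

/-- Evaluation of a derivation at the polynomial `Q`, as a linear map. -/
noncomputable def evalDer {n : ℕ} (Q : MvPolynomial (Fin n) K) :
    Derivation K (MvPolynomial (Fin n) K) (MvPolynomial (Fin n) K) →ₗ[MvPolynomial (Fin n) K]
      MvPolynomial (Fin n) K where
  toFun θ := θ Q
  map_add' _ _ := rfl
  map_smul' _ _ := rfl

/-- The module `D(A) = {θ : θ(Q) ∈ Q·S}` of `A`-derivations (for a chosen defining
polynomial `Q`). -/
noncomputable def DerModule {n : ℕ} (Q : MvPolynomial (Fin n) K) :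
    Submodule (MvPolynomial (Fin n) K)
      (Derivation K (MvPolynomial (Fin n) K) (MvPolynomial (Fin n) K)) :=
  Submodule.comap (evalDer Q) (Ideal.span {Q})

/-- `A` is a free arrangement: `D(A)` is a free module over `S = K[x_1,...,x_n]`. -/
def IsFree {n : ℕ} (A : Arrangement K n) : Prop :=
  ∃ Q, IsDefiningPoly A Q ∧ Module.Free (MvPolynomial (Fin n) K) (DerModule Q)

/-- A nonzero derivation is homogeneous of polynomial degree `p` if all its
coefficients are homogeneous of degree `p`. -/
def IsHomogeneousDer {n : ℕ}
    (θ : Derivation K (MvPolynomial (Fin n) K) (MvPolynomial (Fin n) K)) (p : ℕ) : Prop :=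
  θ ≠ 0 ∧ ∀ i, (θ (MvPolynomial.X i)).IsHomogeneous p

/-- `A` is free with exponents the multiset `e`: `D(A)` has a homogeneous basis whose
polynomial degrees form the multiset `e`. -/
def HasExponents {n : ℕ} (A : Arrangement K n) (e : Multiset ℕ) : Prop :=
  ∃ Q, IsDefiningPoly A Q ∧
    ∃ (l : List ℕ) (b : Basis (Fin l.length) (MvPolynomial (Fin n) K) (DerModule Q)),
      (l : Multiset ℕ) = e ∧ ∀ i : Fin l.length, IsHomogeneousDer ((b i : DerModule Q) :
        Derivation K (MvPolynomial (Fin n) K) (MvPolynomial (Fin n) K)) (l.get i)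

/-- `B` is (a model, via a linear identification `H ≅ K^n`, of) the restriction `A^H`. -/
def IsRestriction {n : ℕ} (A : Arrangement K (n + 1)) (H : Submodule K (Fin (n + 1) → K))
    (B : Arrangement K n) : Prop :=
  ∃ e : H ≃ₗ[K] (Fin n → K),
    B.hyperplanes = (A.hyperplanes.erase H).image
      (fun H' => Submodule.map (e : H →ₗ[K] (Fin n → K)) (H'.comap H.subtype))

variable (K) in
/-- The class of inductively free arrangements. -/
inductive InductivelyFree : {n : ℕ} → Arrangement K n → Prop
  | empty (n : ℕ) : InductivelyFree (emptyArr K n)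
  | add {n : ℕ} (A : Arrangement K (n + 1)) (H : Submodule K (Fin (n + 1) → K))
      (hH : H ∈ A.hyperplanes) (B : Arrangement K n) (hB : IsRestriction A H B)
      (e' e'' : Multiset ℕ)
      (h1 : InductivelyFree (A.delete H)) (h2 : InductivelyFree B)
      (h3 : HasExponents (A.delete H) e') (h4 : HasExponents B e'')
      (h5 : e'' ≤ e') : InductivelyFree A

variable (K) in
/-- The class of recursively free arrangements. -/
inductive RecursivelyFree : {n : ℕ} → Arrangement K n → Prop
  | empty (n : ℕ) : RecursivelyFree (emptyArr K n)
  | add {n : ℕ} (A : Arrangement K (n + 1)) (H : Submodule K (Fin (n + 1) → K))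
      (hH : H ∈ A.hyperplanes) (B : Arrangement K n) (hB : IsRestriction A H B)
      (e' e'' : Multiset ℕ)
      (h1 : RecursivelyFree (A.delete H)) (h2 : RecursivelyFree B)
      (h3 : HasExponents (A.delete H) e') (h4 : HasExponents B e'')
      (h5 : e'' ≤ e') : RecursivelyFree A
  | del {n : ℕ} (A : Arrangement K (n + 1)) (H : Submodule K (Fin (n + 1) → K))
      (hH : H ∈ A.hyperplanes) (B : Arrangement K n) (hB : IsRestriction A H B)
      (e e'' : Multiset ℕ)
      (h1 : RecursivelyFree A) (h2 : RecursivelyFree B)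
      (h3 : HasExponents A e) (h4 : HasExponents B e'')
      (h5 : e'' ≤ e) : RecursivelyFree (A.delete H)

/-- The intersection lattice of a set of hyperplanes: all intersections of finite
subsets (including the ambient space `⊤` as the empty intersection). -/
def setLattice {n : ℕ} (𝓐 : Set (Submodule K (Fin n → K))) : Set (Submodule K (Fin n → K)) :=
  {X | ∃ s : Finset (Submodule K (Fin n → K)), ↑s ⊆ 𝓐 ∧ X = s.inf id}

/-- The intersection lattice of an arrangement. -/
def Arrangement.lattice {n : ℕ} (A : Arrangement K n) : Set (Submodule K (Fin n → K)) :=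
  setLattice (↑A.hyperplanes)

/-- The linear form `x ↦ ∑ v i * x i` attached to a normal vector `v`. -/
noncomputable def lf {n : ℕ} (v : Fin n → K) : (Fin n → K) →ₗ[K] K :=
  ∑ i, v i • LinearMap.proj i

lemma lf_single {n : ℕ} (v : Fin n → K) (j : Fin n) : lf v (Pi.single j 1) = v j := by
  simp [lf, Pi.single_apply, mul_ite, Finset.sum_ite_eq']

lemma lf_ne_zero {n : ℕ} {v : Fin n → K} (hv : v ≠ 0) : lf v ≠ 0 := by
  intro h
  apply hv
  funext j
  have := congrArg (fun f : (Fin n → K) →ₗ[K] K => f (Pi.single j 1)) h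
  simpa [lf_single] using this

/-- The hyperplane `v^⊥` with normal vector `v`. -/
noncomputable def perp {n : ℕ} (v : Fin n → K) : Submodule K (Fin n → K) :=
  LinearMap.ker (lf v)

/-- Build an arrangement from a finite set of nonzero normal vectors. -/
noncomputable def mkArr {n : ℕ} (vs : Finset (Fin n → K)) (h : (0 : Fin n → K) ∉ vs) :
    Arrangement K n :=
  ⟨vs.image perp, by
    intro H hH
    obtain ⟨v, hv, rfl⟩ := Finset.mem_image.mp hH
    exact ⟨lf v, lf_ne_zero (fun h0 => h (h0 ▸ hv)), rfl⟩⟩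

end Arrgt

open Arrgt

instance : Fact (Nat.Prime 11) := ⟨by norm_num⟩

/-- The normal vectors of the arrangement `B` in `𝔽₁₁³`. -/
def Bvecs : List (Fin 3 → ZMod 11) :=
  [![0,0,1], ![0,1,1], ![0,1,2], ![0,1,3], ![0,1,4], ![0,1,5], ![0,1,6],
   ![1,0,0], ![1,0,1], ![1,2,2], ![1,3,1], ![1,3,10], ![1,4,3], ![1,4,4],
   ![1,5,7], ![1,6,4], ![1,6,6], ![1,8,5], ![1,8,8], ![1,9,0], ![1,9,1],
   ![1,9,4], ![1,9,5], ![1,9,8], ![1,9,9], ![1,10,0], ![1,10,5]]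

/-- The seven additional hyperplane normals `H₁, …, H₇`. -/
def Hvecs : List (Fin 3 → ZMod 11) :=
  [![0,1,0], ![1,1,0], ![1,2,0], ![1,3,0], ![1,4,0], ![1,5,0], ![1,7,0]]

namespace Arrgt

section LinearForms

open MvPolynomial

variable {K : Type*} [Field K] {n : ℕ}

lemma apply_eq_sum (f : (Fin n → K) →ₗ[K] K) (x : Fin n → K) :
    f x = ∑ i, f (Pi.single i 1) * x i := by
  conv_lhs => rw [← Finset.univ_sum_single x, map_sum]
  refine Finset.sum_congr rfl fun i _ => ?_
  have : (Pi.single i (x i) : Fin n → K) = x i • Pi.single i 1 := by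
    rw [← Pi.single_smul, smul_eq_mul, mul_one]
  rw [this, map_smul, smul_eq_mul, mul_comm]

lemma eval_linPoly (f : (Fin n → K) →ₗ[K] K) (x : Fin n → K) : eval x (linPoly f) = f x := by
  simp [linPoly, apply_eq_sum f x]

lemma linPoly_sub (f g : (Fin n → K) →ₗ[K] K) : linPoly (f - g) = linPoly f - linPoly g := by
  simp [linPoly, sub_mul]

lemma linPoly_add (f g : (Fin n → K) →ₗ[K] K) : linPoly (f + g) = linPoly f + linPoly g := by
  simp [linPoly, add_mul, Finset.sum_add_distrib]

lemma linPoly_smul (c : K) (f : (Fin n → K) →ₗ[K] K) : linPoly (c • f) = C c * linPoly f := by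
  simp [linPoly, Finset.mul_sum, mul_assoc]

lemma linPoly_zero : linPoly (0 : (Fin n → K) →ₗ[K] K) = 0 := by
  simp [linPoly]

lemma linPoly_eq_zero_iff {f : (Fin n → K) →ₗ[K] K} : linPoly f = 0 ↔ f = 0 := by
  refine ⟨fun h => ?_, fun h => h ▸ linPoly_zero⟩
  ext1 i
  ext
  simp [← eval_linPoly, h]

lemma linPoly_isHomogeneous (f : (Fin n → K) →ₗ[K] K) : (linPoly f).IsHomogeneous 1 :=
  IsHomogeneous.sum _ _ _ fun _ _ => isHomogeneous_C_mul_X _ _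

lemma derivation_linPoly
    (θ : Derivation K (MvPolynomial (Fin n) K) (MvPolynomial (Fin n) K))
    (f : (Fin n → K) →ₗ[K] K) :
    θ (linPoly f) = ∑ i, C (f (Pi.single i 1)) * θ (X i) := by
  simp [linPoly, derivation_C]

lemma exists_apply_eq_one {f : (Fin n → K) →ₗ[K] K} (hf : f ≠ 0) : ∃ u, f u = 1 := by
  obtain ⟨u, hu⟩ : ∃ u, f u ≠ 0 := by
    by_contra! h
    exact hf (LinearMap.ext h)
  exact ⟨(f u)⁻¹ • u, by simp [hu]⟩

lemma exists_eq_smul_of_ker_eq {f g : (Fin n → K) →ₗ[K] K} (hf : f ≠ 0)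
    (h : LinearMap.ker f = LinearMap.ker g) : ∃ c : K, c ≠ 0 ∧ g = c • f := by
  obtain ⟨u, hu⟩ := exists_apply_eq_one hf
  have hgu : g u ≠ 0 := fun h0 => by
    have : u ∈ LinearMap.ker f := by rw [h]; exact h0
    rw [LinearMap.mem_ker, hu] at this
    exact one_ne_zero this
  refine ⟨g u, hgu, LinearMap.ext fun x => ?_⟩
  have : x - f x • u ∈ LinearMap.ker g := by
    rw [← h]; simp [hu]
  have := LinearMap.mem_ker.mp this
  rw [map_sub, map_smul, sub_eq_zero] at this
  simp [this, mul_comm]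

/-- The substitution `x ↦ x - f(x) u`. When `f u = 1` it is the pullback along the projection
onto `ker f` parallel to `u`, and its kernel is generated by `linPoly f`. -/
noncomputable def kerProj (f : (Fin n → K) →ₗ[K] K) (u : Fin n → K) :
    MvPolynomial (Fin n) K →ₐ[K] MvPolynomial (Fin n) K :=
  aeval fun i => X i - C (u i) * linPoly f

variable {f : (Fin n → K) →ₗ[K] K} {u : Fin n → K}

lemma kerProj_linPoly (g : (Fin n → K) →ₗ[K] K) :
    kerProj f u (linPoly g) = linPoly (g - g u • f) := by
  rw [linPoly_sub, linPoly_smul, apply_eq_sum g u]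
  conv_lhs => rw [linPoly]
  simp only [kerProj, map_sum, map_mul, aeval_X, mul_sub, Finset.sum_sub_distrib, algHom_C,
    algebraMap_eq, ← mul_assoc, Finset.sum_mul]
  rfl

lemma dvd_sub_kerProj (p : MvPolynomial (Fin n) K) : linPoly f ∣ p - kerProj f u p := by
  induction p using MvPolynomial.induction_on with
  | C a => simp [kerProj]
  | add p q hp hq =>
    rw [map_add, add_sub_add_comm]
    exact dvd_add hp hq
  | mul_X p i hp =>
    have : p * X i - kerProj f u (p * X i) = (p - kerProj f u p) * X i +
        kerProj f u p * (C (u i) * linPoly f) := by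
      rw [map_mul]
      simp only [kerProj, aeval_X]
      ring
    rw [this]
    exact dvd_add (hp.mul_right _) ⟨kerProj f u p * C (u i), by ring⟩

lemma kerProj_linPoly_self (hu : f u = 1) : kerProj f u (linPoly f) = 0 := by
  simp [kerProj_linPoly, hu, linPoly_zero]

lemma kerProj_eq_zero_iff (hu : f u = 1) {p : MvPolynomial (Fin n) K} :
    kerProj f u p = 0 ↔ linPoly f ∣ p := by
  constructor
  · intro h
    simpa [h] using dvd_sub_kerProj (f := f) (u := u) p
  · rintro ⟨q, rfl⟩
    rw [map_mul, kerProj_linPoly_self hu, zero_mul]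

lemma kerProj_kerProj (hu : f u = 1) (p : MvPolynomial (Fin n) K) :
    kerProj f u (kerProj f u p) = kerProj f u p := by
  have := (kerProj_eq_zero_iff hu).mpr (dvd_sub_kerProj (f := f) (u := u) p)
  rw [map_sub, sub_eq_zero] at this
  exact this.symm

lemma kerProj_isHomogeneous {p : MvPolynomial (Fin n) K} {d : ℕ} (hp : p.IsHomogeneous d) :
    (kerProj f u p).IsHomogeneous d := by
  rw [← one_mul d]
  exact hp.aeval (n := 1) (fun i => X i - C (u i) * linPoly f)
    fun i => (isHomogeneous_X _ _).sub ((linPoly_isHomogeneous f).C_mul _)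

lemma prime_linPoly {f : (Fin n → K) →ₗ[K] K} (hf : f ≠ 0) : Prime (linPoly f) := by
  obtain ⟨u, hu⟩ := exists_apply_eq_one hf
  refine ⟨fun h => hf (linPoly_eq_zero_iff.mp h), fun h => ?_, fun p q h => ?_⟩
  · have := (kerProj_eq_zero_iff hu).mpr (h.dvd (a := 1))
    simp at this
  · rw [← kerProj_eq_zero_iff hu, map_mul, mul_eq_zero] at h
    exact h.imp (kerProj_eq_zero_iff hu).mp (kerProj_eq_zero_iff hu).mp

lemma ker_eq_of_linPoly_dvd {f g : (Fin n → K) →ₗ[K] K} (hf : f ≠ 0) (hg : g ≠ 0)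
    (h : linPoly f ∣ linPoly g) : LinearMap.ker f = LinearMap.ker g := by
  obtain ⟨u, hu⟩ := exists_apply_eq_one hf
  rw [← kerProj_eq_zero_iff hu, kerProj_linPoly, linPoly_eq_zero_iff, sub_eq_zero] at h
  rw [h, LinearMap.ker_smul]
  rintro h0
  rw [h0, zero_smul] at h
  exact hg h

lemma isRelPrime_linPoly {f g : (Fin n → K) →ₗ[K] K} (hf : f ≠ 0) (hg : g ≠ 0)
    (h : LinearMap.ker f ≠ LinearMap.ker g) : IsRelPrime (linPoly f) (linPoly g) :=
  (prime_linPoly hf).irreducible.isRelPrime_iff_not_dvd.mpr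
    fun hd => h (ker_eq_of_linPoly_dvd hf hg hd)

lemma isHomogeneous_of_mul {p q : MvPolynomial (Fin n) K} {a d : ℕ} (hp : p.IsHomogeneous a)
    (hp0 : p ≠ 0) (hpq : (p * q).IsHomogeneous (a + d)) : q.IsHomogeneous d := by
  have h : homogeneousComponent (a + d) (p * q) = p * homogeneousComponent d q := by
    conv_lhs => rw [← sum_homogeneousComponent q, Finset.mul_sum, map_sum]
    have : ∀ e, homogeneousComponent (a + d) (p * homogeneousComponent e q) =
        if e = d then p * homogeneousComponent d q else 0 := fun e => by
      rw [homogeneousComponent_of_mem (hp.mul (homogeneousComponent_isHomogeneous e q))]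
      by_cases h : e = d
      · simp [h]
      · simp [h, Ne.symm h]
    simp only [this, Finset.sum_ite_eq', Finset.mem_range]
    split_ifs with hd
    · rfl
    · rw [homogeneousComponent_eq_zero _ _ (by omega), mul_zero]
  rw [homogeneousComponent_eq_self hpq] at h
  rw [mul_left_cancel₀ hp0 h]
  exact homogeneousComponent_isHomogeneous _ _

end LinearForms

section LogDerivations

open MvPolynomial

variable {K : Type*} [Field K] {n : ℕ}

/-- The module of logarithmic derivations of `A`, described hyperplane by hyperplane. -/
noncomputable def logDer (A : Arrangement K n) : Submodule (MvPolynomial (Fin n) K)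
    (Derivation K (MvPolynomial (Fin n) K) (MvPolynomial (Fin n) K)) where
  carrier := {θ | ∀ H ∈ A.hyperplanes, ∀ f, LinearMap.ker f = H → linPoly f ∣ θ (linPoly f)}
  add_mem' h₁ h₂ H hH f hf := dvd_add (h₁ H hH f hf) (h₂ H hH f hf)
  zero_mem' _ _ _ _ := dvd_zero _
  smul_mem' r _ h H hH f hf := (h H hH f hf).mul_left r

lemma Arrangement.exists_forms (A : Arrangement K n) :
    ∃ α : Submodule K (Fin n → K) → ((Fin n → K) →ₗ[K] K),
      ∀ H ∈ A.hyperplanes, α H ≠ 0 ∧ LinearMap.ker (α H) = H := by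
  choose α hα using A.isHyp
  refine ⟨fun H => if h : H ∈ A.hyperplanes then α H h else 0, fun H hH => ?_⟩
  simp only [hH, dif_pos]
  exact ⟨(hα H hH).1, (hα H hH).2.symm⟩

lemma mem_logDer_iff {A : Arrangement K n}
    {α : Submodule K (Fin n → K) → ((Fin n → K) →ₗ[K] K)}
    (hα : ∀ H ∈ A.hyperplanes, α H ≠ 0 ∧ LinearMap.ker (α H) = H)
    {θ : Derivation K (MvPolynomial (Fin n) K) (MvPolynomial (Fin n) K)} :
    θ ∈ logDer A ↔ ∀ H ∈ A.hyperplanes, linPoly (α H) ∣ θ (linPoly (α H)) := by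
  refine ⟨fun h H hH => h H hH _ (hα H hH).2, fun h H hH f hf => ?_⟩
  obtain ⟨c, hc, rfl⟩ := exists_eq_smul_of_ker_eq (hα H hH).1 ((hα H hH).2.trans hf.symm)
  rw [linPoly_smul, ← smul_eq_C_mul, Derivation.map_smul, smul_eq_C_mul, smul_eq_C_mul]
  exact mul_dvd_mul_left _ (h H hH)

lemma derModule_eq_logDer {A : Arrangement K n} {Q : MvPolynomial (Fin n) K}
    (hQ : IsDefiningPoly A Q) : DerModule Q = logDer A := by
  obtain ⟨α, hα, rfl⟩ := hQ
  ext θ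
  rw [mem_logDer_iff hα, DerModule, Submodule.mem_comap, Ideal.mem_span_singleton]
  change _ ∣ θ _ ↔ _
  constructor
  · intro h H hH
    rw [← Finset.mul_prod_erase _ _ hH, Derivation.leibniz, smul_eq_mul, smul_eq_mul] at h
    have h1 := (dvd_add_right (dvd_mul_right _ _)).mp ((dvd_mul_right _ _).trans h)
    refine ((prime_linPoly (hα H hH).1).dvd_or_dvd h1).resolve_left fun h2 => ?_
    obtain ⟨L, hL, h3⟩ := ((prime_linPoly (hα H hH).1).dvd_finsetProd_iff _).mp h2
    rw [Finset.mem_erase] at hL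
    have := ker_eq_of_linPoly_dvd (hα H hH).1 (hα L hL.2).1 h3
    rw [(hα H hH).2, (hα L hL.2).2] at this
    exact hL.1 this.symm
  · intro h
    have : ∀ s : Finset (Submodule K (Fin n → K)), s ⊆ A.hyperplanes →
        ∏ H ∈ s, linPoly (α H) ∣ θ (∏ H ∈ s, linPoly (α H)) := by
      intro s
      induction s using Finset.induction_on with
      | empty => simp
      | insert H s hH ih =>
        intro hs
        rw [Finset.prod_insert hH, Derivation.leibniz, smul_eq_mul, smul_eq_mul]
        refine dvd_add (mul_dvd_mul_left _ (ih ((Finset.subset_insert _ _).trans hs))) ?_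
        exact (mul_dvd_mul_right (h H (hs (Finset.mem_insert_self _ _))) _).trans
          (dvd_of_eq (mul_comm _ _))
    exact this _ subset_rfl

lemma exists_equiv_of_map_univ_eq {ι κ γ : Type*} [Fintype ι] [Fintype κ] {f : ι → γ}
    {g : κ → γ} (h : Finset.univ.val.map f = Finset.univ.val.map g) :
    ∃ σ : ι ≃ κ, ∀ i, g (σ i) = f i := by
  have key : ∀ c, Nonempty ({i // f i = c} ≃ {j // g j = c}) := fun c => by
    refine Fintype.card_eq.mp ?_
    have := congrArg (Multiset.count c) h
    rw [Multiset.count_map, Multiset.count_map] at this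
    rw [Fintype.card_subtype, Fintype.card_subtype]
    simpa only [eq_comm, Finset.card, Finset.filter_val] using this
  exact ⟨Equiv.ofFiberEquiv fun c => (key c).some, fun i => Equiv.ofFiberEquiv_map _ i⟩

lemma hasExponents_of_basis {A : Arrangement K n} {d : Fin n → ℕ}
    (b : Basis (Fin n) (MvPolynomial (Fin n) K) (logDer A))
    (hb : ∀ i, IsHomogeneousDer (b i).1 (d i)) :
    HasExponents A (Finset.univ.val.map d) := by
  obtain ⟨α, hα⟩ := A.exists_forms
  refine ⟨_, ⟨α, hα, rfl⟩, List.ofFn d, ?_⟩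
  rw [derModule_eq_logDer ⟨α, hα, rfl⟩]
  refine ⟨b.reindex (finCongr (by simp)), ?_, fun i => ?_⟩
  · simp
  · rw [Basis.reindex_apply, List.get_ofFn]
    exact hb _

lemma HasExponents.exists_basis {A : Arrangement K n} {d : Fin n → ℕ}
    (h : HasExponents A (Finset.univ.val.map d)) :
    ∃ b : Basis (Fin n) (MvPolynomial (Fin n) K) (logDer A),
      ∀ i, IsHomogeneousDer (b i).1 (d i) := by
  obtain ⟨Q, hQ, h⟩ := h
  rw [derModule_eq_logDer hQ] at h
  obtain ⟨l, b, hl, hb⟩ := h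
  have hl' : Finset.univ.val.map d = Finset.univ.val.map l.get := by
    rw [← hl, Fin.univ_val_map, List.ofFn_get]
  obtain ⟨σ, hσ⟩ := exists_equiv_of_map_univ_eq hl'
  refine ⟨b.reindex σ.symm, fun i => ?_⟩
  rw [Basis.reindex_apply, Equiv.symm_symm, ← hσ]
  exact hb _

end LogDerivations

end Arrgt

namespace Arrgt

section Addition

open MvPolynomial

variable {K : Type*} [Field K] {n : ℕ}

lemma eq_zero_of_isHomogeneous_of_dvd {p q : MvPolynomial (Fin n) K} {a d : ℕ}
    (hp : p.IsHomogeneous a) (hq : q.IsHomogeneous d) (had : d < a) (h : p ∣ q) : q = 0 := by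
  by_contra hq0
  obtain ⟨r, rfl⟩ := h
  have hp0 := left_ne_zero_of_mul hq0
  have := hq.totalDegree hq0
  rw [totalDegree_mul_of_isDomain hp0 (right_ne_zero_of_mul hq0), hp.totalDegree hp0] at this
  omega

lemma mem_logDer_iff_delete {A : Arrangement K n} {f : (Fin n → K) →ₗ[K] K} (hf : f ≠ 0)
    (hH : LinearMap.ker f ∈ A.hyperplanes)
    {θ : Derivation K (MvPolynomial (Fin n) K) (MvPolynomial (Fin n) K)} :
    θ ∈ logDer A ↔
      θ ∈ logDer (A.delete (LinearMap.ker f)) ∧ linPoly f ∣ θ (linPoly f) := by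
  refine ⟨fun h => ⟨fun H' hH' => h H' (Finset.mem_of_mem_erase hH'), h _ hH f rfl⟩,
    fun ⟨h₁, h₂⟩ H' hH' g hg => ?_⟩
  by_cases h : H' = LinearMap.ker f
  · obtain ⟨c, -, rfl⟩ := exists_eq_smul_of_ker_eq hf (h.symm.trans hg.symm)
    rw [linPoly_smul, ← smul_eq_C_mul, Derivation.map_smul, smul_eq_C_mul, smul_eq_C_mul]
    exact mul_dvd_mul_left _ h₂
  · exact h₁ H' (Finset.mem_erase.mpr ⟨h, hH'⟩) g hg

/-- The form `g`, made to vanish on `u` without changing its restriction to `ker f`. -/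
noncomputable def restrForm (f g : (Fin n → K) →ₗ[K] K) (u : Fin n → K) :
    (Fin n → K) →ₗ[K] K := g - g u • f

variable {f : (Fin n → K) →ₗ[K] K} {u : Fin n → K}

lemma restrForm_ne_zero {g : (Fin n → K) →ₗ[K] K} (hg : g ≠ 0)
    (h : LinearMap.ker g ≠ LinearMap.ker f) : restrForm f g u ≠ 0 := by
  intro h0
  rw [restrForm, sub_eq_zero] at h0
  have hgu : g u ≠ 0 := fun h1 => hg (by rw [h0, h1, zero_smul])
  exact h (by rw [h0, LinearMap.ker_smul _ _ hgu])

lemma ker_restrForm_eq_iff (hu : f u = 1) {g g' : (Fin n → K) →ₗ[K] K} :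
    LinearMap.ker (restrForm f g u) = LinearMap.ker (restrForm f g' u) ↔
      LinearMap.ker g ⊓ LinearMap.ker f = LinearMap.ker g' ⊓ LinearMap.ker f := by
  have key : ∀ (g : (Fin n → K) →ₗ[K] K) x, restrForm f g u x = g (x - f x • u) := fun g x => by
    simp [restrForm, mul_comm]
  have hproj : ∀ x, f (x - f x • u) = 0 := fun x => by simp [hu]
  constructor
  · intro h
    ext x
    simp only [Submodule.mem_inf, LinearMap.mem_ker]
    refine and_congr_left fun hx => ?_
    have := SetLike.ext_iff.mp h x
    simpa [key, hx] using this
  · intro h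
    ext x
    have := SetLike.ext_iff.mp h (x - f x • u)
    simpa only [Submodule.mem_inf, LinearMap.mem_ker, hproj, and_true, key] using this

/-- If `g'` agrees with a multiple of `g` on `ker f`, then tangency of `θ` to `ker g'` controls
the mixed expression `g θ(f) - f θ(g)`. -/
lemma linPoly_dvd_mixed {g g' : (Fin n → K) →ₗ[K] K} (hu : f u = 1)
    (hg : restrForm f g u ≠ 0)
    (h : LinearMap.ker g ⊓ LinearMap.ker f = LinearMap.ker g' ⊓ LinearMap.ker f)
    {θ : Derivation K (MvPolynomial (Fin n) K) (MvPolynomial (Fin n) K)}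
    (hθ : linPoly g' ∣ θ (linPoly g')) :
    linPoly g' ∣ linPoly g * θ (linPoly f) - linPoly f * θ (linPoly g) := by
  obtain ⟨c, hc, hcg⟩ := exists_eq_smul_of_ker_eq hg ((ker_restrForm_eq_iff hu).mpr h)
  obtain ⟨e, he⟩ : ∃ e : K, g' = c • g + e • f := by
    refine ⟨g' u - c * g u, ?_⟩
    rw [restrForm, restrForm, sub_eq_iff_eq_add] at hcg
    conv_lhs => rw [hcg]
    module
  have h1 : linPoly g' ∣ linPoly g' * θ (linPoly f) - linPoly f * θ (linPoly g') :=
    dvd_sub (dvd_mul_right _ _) (hθ.mul_left _)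
  have h2 : linPoly g' * θ (linPoly f) - linPoly f * θ (linPoly g') =
      C c * (linPoly g * θ (linPoly f) - linPoly f * θ (linPoly g)) := by
    rw [he, linPoly_add, linPoly_smul, linPoly_smul, map_add, ← smul_eq_C_mul,
      ← smul_eq_C_mul (linPoly f) e, Derivation.map_smul, Derivation.map_smul]
    simp only [smul_eq_C_mul]
    ring
  rw [h2] at h1
  have h3 := h1.mul_left (C c⁻¹)
  rwa [← mul_assoc, ← C_mul, inv_mul_cancel₀ hc, C_1, one_mul] at h3

/-- The number of hyperplanes of the restriction `A^H`. -/
noncomputable def Arrangement.restrCard (A : Arrangement K n) (H : Submodule K (Fin n → K)) : ℕ :=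
  ((A.hyperplanes.erase H).image fun L => L ⊓ H).card

lemma isRelPrime_kerProj {g g' : (Fin n → K) →ₗ[K] K} (hu : f u = 1)
    (hg : restrForm f g u ≠ 0) (hg' : restrForm f g' u ≠ 0)
    (h : LinearMap.ker g ⊓ LinearMap.ker f ≠ LinearMap.ker g' ⊓ LinearMap.ker f) :
    IsRelPrime (kerProj f u (linPoly g)) (kerProj f u (linPoly g')) := by
  rw [kerProj_linPoly, kerProj_linPoly]
  exact isRelPrime_linPoly hg hg' fun h' => h ((ker_restrForm_eq_iff hu).mp h')

lemma exists_dvd_kerProj {A : Arrangement K n} {f : (Fin n → K) →ₗ[K] K} {u : Fin n → K}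
    (hu : f u = 1) :
    ∃ B : MvPolynomial (Fin n) K, B ≠ 0 ∧ kerProj f u B = B ∧
      B.IsHomogeneous
        ((A.delete (LinearMap.ker f)).hyperplanes.card - A.restrCard (LinearMap.ker f)) ∧
      ∀ θ ∈ logDer (A.delete (LinearMap.ker f)), B ∣ kerProj f u (θ (linPoly f)) := by
  obtain ⟨α, hα⟩ := (A.delete (LinearMap.ker f)).exists_forms
  set s := (A.delete (LinearMap.ker f)).hyperplanes with hs
  have hne : ∀ L ∈ s, restrForm f (α L) u ≠ 0 := fun L hL =>
    restrForm_ne_zero (hα L hL).1 (by rw [(hα L hL).2]; exact (Finset.mem_erase.mp hL).1)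
  set T := s.image fun L => L ⊓ LinearMap.ker f with hT
  have hrep : ∀ X, ∃ L, X ∈ T → L ∈ s ∧ L ⊓ LinearMap.ker f = X := fun X => by
    by_cases hX : X ∈ T
    · obtain ⟨L, hL⟩ := Finset.mem_image.mp hX
      exact ⟨L, fun _ => hL⟩
    · exact ⟨⊥, fun h => absurd h hX⟩
  choose rep hrep using hrep
  set cls := fun X => s.filter fun L => L ⊓ LinearMap.ker f = X with hcls
  have hrepcls : ∀ X ∈ T, rep X ∈ cls X := fun X hX => by simpa [cls] using hrep X hX
  refine ⟨∏ X ∈ T, ∏ L ∈ (cls X).erase (rep X), kerProj f u (linPoly (α L)), ?_, ?_, ?_, ?_⟩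
  · refine Finset.prod_ne_zero_iff.mpr fun X _ => Finset.prod_ne_zero_iff.mpr fun L hL => ?_
    rw [kerProj_linPoly]
    exact fun h => hne L (Finset.mem_filter.mp (Finset.mem_of_mem_erase hL)).1
      (linPoly_eq_zero_iff.mp h)
  · simp only [map_prod, kerProj_kerProj hu]
  · have hdeg : s.card - A.restrCard (LinearMap.ker f) =
        ∑ X ∈ T, ∑ L ∈ (cls X).erase (rep X), 1 := by
      have h1 : s.card = ∑ X ∈ T, (cls X).card :=
        Finset.card_eq_sum_card_image (fun L => L ⊓ LinearMap.ker f) s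
      have h2 : ∀ X ∈ T, (cls X).card = ∑ L ∈ (cls X).erase (rep X), 1 + 1 := fun X hX => by
        rw [Finset.sum_const, smul_eq_mul, mul_one, Finset.card_erase_add_one (hrepcls X hX)]
      rw [h1, Finset.sum_congr rfl h2, Finset.sum_add_distrib, Finset.sum_const, smul_eq_mul,
        mul_one]
      change _ + T.card - T.card = _
      rw [Nat.add_sub_cancel]
    rw [hdeg]
    exact IsHomogeneous.prod _ _ _ fun X _ => IsHomogeneous.prod _ _ _ fun L _ =>
      kerProj_isHomogeneous (linPoly_isHomogeneous _)
  · intro θ hθ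
    refine Finset.prod_dvd_of_isRelPrime ?_ fun X hX => ?_
    · intro X _ Y _ hXY
      refine IsRelPrime.prod_left fun L hL => IsRelPrime.prod_right fun L' hL' => ?_
      obtain ⟨hL, hLX⟩ := Finset.mem_filter.mp (Finset.mem_of_mem_erase hL)
      obtain ⟨hL', hLY⟩ := Finset.mem_filter.mp (Finset.mem_of_mem_erase hL')
      refine isRelPrime_kerProj hu (hne L hL) (hne L' hL') ?_
      rw [(hα L hL).2, (hα L' hL').2, hLX, hLY]
      exact hXY
    · obtain ⟨hr, hrX⟩ := hrep X hX
      set p := linPoly (α (rep X)) * θ (linPoly f) - linPoly f * θ (linPoly (α (rep X))) with hp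
      have h1 : ∏ L ∈ cls X, linPoly (α L) ∣ p := by
        refine Finset.prod_dvd_of_isRelPrime (fun L hL L' hL' hLL => ?_) fun L hL => ?_
        · have hL := (Finset.mem_filter.mp hL).1
          have hL' := (Finset.mem_filter.mp hL').1
          refine isRelPrime_linPoly (hα L hL).1 (hα L' hL').1 ?_
          rwa [(hα L hL).2, (hα L' hL').2]
        · obtain ⟨hL, hLX⟩ := Finset.mem_filter.mp hL
          refine linPoly_dvd_mixed hu (hne _ hr) ?_ (hθ L hL _ (hα L hL).2)
          rw [(hα _ hr).2, (hα L hL).2, hrX, hLX]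
      have h2 := map_dvd (kerProj f u) h1
      rw [map_prod, hp, map_sub, map_mul, map_mul, kerProj_linPoly_self hu, zero_mul, sub_zero,
        ← Finset.mul_prod_erase _ _ (hrepcls X hX)] at h2
      refine (mul_dvd_mul_iff_left ?_).mp h2
      rw [kerProj_linPoly]
      exact fun h => hne _ hr (linPoly_eq_zero_iff.mp h)

/-- Rescaling one basis vector of a module after a unimodular change of the others, to get a
basis of a submodule. -/
lemma exists_basis_submodule {R M ι : Type*} [CommRing R] [IsDomain R] [AddCommGroup M]
    [Module R M] [Fintype ι] {N N' : Submodule R M} (hN : N ≤ N') (b : Basis ι R N')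
    (i₀ : ι) (c : ι → R) {r : R} (hr : r ≠ 0)
    (h₁ : ∀ j ≠ i₀, (b j : M) - c j • (b i₀ : M) ∈ N) (h₂ : r • (b i₀ : M) ∈ N)
    (h₃ : ∀ t : R, t • (b i₀ : M) ∈ N → r ∣ t) :
    ∃ b' : Basis ι R N,
      (b' i₀ : M) = r • (b i₀ : M) ∧ ∀ j ≠ i₀, (b' j : M) = b j - c j • (b i₀ : M) := by
  set v : ι → M := fun j => if j = i₀ then r • (b i₀ : M) else b j - c j • (b i₀ : M) with hv
  have hvN : ∀ j, v j ∈ N := fun j => by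
    by_cases hj : j = i₀
    · simpa [hv, hj] using h₂
    · simpa [hv, hj] using h₁ j hj
  have hli : LinearIndependent R fun j => (⟨v j, hvN j⟩ : N) := by
    rw [Fintype.linearIndependent_iff]
    intro g hg
    have hg' : ∑ j, g j • (if j = i₀ then r • b i₀ else b j - c j • b i₀) = 0 := by
      apply Subtype.ext
      have := congrArg (Subtype.val : N → M) hg
      simp only [Submodule.coe_sum, Submodule.coe_smul, Submodule.coe_zero] at this ⊢
      rw [← this]
      refine Finset.sum_congr rfl fun j _ => ?_
      simp only [hv]
      split_ifs <;> simp
    have hco : ∀ k, ∑ j, g j * (if j = i₀ then r * (if i₀ = k then 1 else 0)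
        else (if j = k then 1 else 0) - c j * (if i₀ = k then 1 else 0)) = 0 := fun k => by
      have := congrArg (fun x => b.repr x k) hg'
      simp only [map_sum, map_smul, Finsupp.coe_finsetSum, Finset.sum_apply, Finsupp.smul_apply,
        map_zero, Finsupp.zero_apply, smul_eq_mul] at this
      rw [← this]
      refine Finset.sum_congr rfl fun j _ => ?_
      congr 1
      split_ifs <;> simp_all
    have h0 : ∀ k ≠ i₀, g k = 0 := fun k hk => by
      have := hco k
      rw [Finset.sum_eq_single k] at this
      · simpa [hk, Ne.symm hk] using this
      · intro j _ hj
        simp [hj, Ne.symm hk]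
      · simp
    intro k
    by_cases hk : k = i₀
    · have := hco i₀
      rw [Finset.sum_eq_single i₀] at this
      · rw [hk]
        simpa [hr] using this
      · intro j _ hj
        rw [h0 j hj, zero_mul]
      · simp
    · exact h0 k hk
  have hsp : ⊤ ≤ Submodule.span R (Set.range fun j => (⟨v j, hvN j⟩ : N)) := by
    rintro ⟨x, hx⟩ -
    set ρ := b.repr ⟨x, hN hx⟩ with hρ
    have hx1 : x = ∑ j, ρ j • (b j : M) := by
      have h := congrArg (Subtype.val : N' → M) (b.sum_repr ⟨x, hN hx⟩)
      simp only [Submodule.coe_sum, Submodule.coe_smul] at h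
      exact h.symm
    set t := ρ i₀ + ∑ j ∈ Finset.univ.erase i₀, ρ j * c j with ht
    have hx2 : x = ∑ j ∈ Finset.univ.erase i₀, ρ j • v j + t • (b i₀ : M) := by
      rw [hx1, ← Finset.add_sum_erase _ _ (Finset.mem_univ i₀), ht, add_smul, Finset.sum_smul,
        ← add_assoc, add_comm _ (ρ i₀ • (b i₀ : M)), add_assoc, ← Finset.sum_add_distrib]
      congr 1
      refine Finset.sum_congr rfl fun j hj => ?_
      simp only [hv, if_neg (Finset.ne_of_mem_erase hj)]
      module
    obtain ⟨q, hq⟩ : r ∣ t := by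
      refine h₃ t ?_
      rw [show t • (b i₀ : M) = x - ∑ j ∈ Finset.univ.erase i₀, ρ j • v j by
        rw [hx2]; simp]
      exact N.sub_mem hx (N.sum_mem fun j _ => N.smul_mem _ (hvN j))
    have hx3 : (⟨x, hx⟩ : N) = ∑ j ∈ Finset.univ.erase i₀, ρ j • (⟨v j, hvN j⟩ : N) +
        q • (⟨v i₀, hvN i₀⟩ : N) := by
      apply Subtype.ext
      simp only [Submodule.coe_add, Submodule.coe_sum, Submodule.coe_smul]
      conv_lhs => rw [hx2, hq]
      simp [hv, mul_smul, smul_comm q r]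
    rw [hx3]
    exact Submodule.add_mem _
      (Submodule.sum_mem _ fun j _ => Submodule.smul_mem _ _ (Submodule.subset_span ⟨j, rfl⟩))
      (Submodule.smul_mem _ _ (Submodule.subset_span ⟨i₀, rfl⟩))
  refine ⟨Basis.mk hli hsp, ?_, fun j hj => ?_⟩
  · simp [hv]
  · simp [hv, hj]

lemma exists_basis_of_kerProj_ne_zero {A : Arrangement K n} (hu : f u = 1)
    (hH : LinearMap.ker f ∈ A.hyperplanes) {d : Fin n → ℕ}
    (b : Basis (Fin n) (MvPolynomial (Fin n) K) (logDer (A.delete (LinearMap.ker f))))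
    (hb : ∀ i, IsHomogeneousDer (b i).1 (d i)) {i₀ : Fin n}
    (hd : d i₀ = (A.delete (LinearMap.ker f)).hyperplanes.card - A.restrCard (LinearMap.ker f))
    (hi₀ : kerProj f u ((b i₀).1 (linPoly f)) ≠ 0) :
    HasExponents A (Finset.univ.val.map (Function.update d i₀ (d i₀ + 1))) := by
  have hf : f ≠ 0 := fun h => by simp [h] at hu
  obtain ⟨B, hB0, hBπ, hBh, hB⟩ := exists_dvd_kerProj (A := A) hu
  rw [← hd] at hBh
  have hpoly : ∀ j, ((b j).1 (linPoly f)).IsHomogeneous (d j) := fun j => by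
    rw [derivation_linPoly]
    exact IsHomogeneous.sum _ _ _ fun k _ => ((hb j).2 k).C_mul _
  have hg : ∀ j, ∃ g, kerProj f u ((b j).1 (linPoly f)) = B * g ∧ kerProj f u g = g ∧
      ∀ p : MvPolynomial (Fin n) K, p.IsHomogeneous (d i₀) → (g * p).IsHomogeneous (d j) := by
    intro j
    have hj := kerProj_isHomogeneous (f := f) (u := u) (hpoly j)
    have hdvd := hB _ (b j).2
    by_cases hlt : d j < d i₀
    · refine ⟨0, ?_, map_zero _, fun p _ => by rw [zero_mul]; exact isHomogeneous_zero _ _ _⟩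
      rw [eq_zero_of_isHomogeneous_of_dvd hBh hj hlt hdvd, mul_zero]
    · obtain ⟨e, he⟩ := Nat.exists_eq_add_of_le (not_lt.mp hlt)
      obtain ⟨g, hg⟩ := hdvd
      refine ⟨g, hg, ?_, fun p hp => ?_⟩
      · have := congrArg (kerProj f u) hg
        rw [kerProj_kerProj hu, map_mul, hBπ, hg] at this
        exact (mul_left_cancel₀ hB0 this).symm
      · rw [hg, he] at hj
        rw [he, add_comm]
        exact (isHomogeneous_of_mul hBh hB0 hj).mul hp
  choose g hg hgπ hgh using hg
  obtain ⟨c, hc⟩ : ∃ c, g i₀ = C c := by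
    have h1 := kerProj_isHomogeneous (f := f) (u := u) (hpoly i₀)
    rw [hg, ← add_zero (d i₀)] at h1
    have := (totalDegree_zero_iff_isHomogeneous _).mpr (isHomogeneous_of_mul hBh hB0 h1)
    exact ⟨_, totalDegree_eq_zero_iff_eq_C.mp this⟩
  have hc0 : c ≠ 0 := by
    rintro rfl
    rw [hg, hc, C_0, mul_zero] at hi₀
    exact hi₀ rfl
  have hmem := @mem_logDer_iff_delete K _ n A f hf hH
  obtain ⟨b', hb'₀, hb'⟩ := exists_basis_submodule (N := logDer A)
    (fun θ hθ => (hmem.mp hθ).1) b i₀ (fun j => C c⁻¹ * g j)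
    (prime_linPoly hf).ne_zero
    (fun j _ => hmem.mpr ⟨Submodule.sub_mem _ (b j).2 (Submodule.smul_mem _ _ (b i₀).2), by
      rw [← kerProj_eq_zero_iff hu, Derivation.sub_apply, Derivation.smul_apply, smul_eq_mul,
        map_sub, map_mul, map_mul, hg, hg, hgπ, hc, algHom_C, algebraMap_eq,
        show C c⁻¹ * g j * (B * C c) = C (c⁻¹ * c) * (B * g j) by rw [C_mul]; ring,
        inv_mul_cancel₀ hc0, C_1, one_mul, sub_self]⟩)
    (hmem.mpr ⟨Submodule.smul_mem _ _ (b i₀).2, dvd_mul_right _ _⟩)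
    (fun t ht => by
      have := (hmem.mp ht).2
      rw [← kerProj_eq_zero_iff hu, Derivation.smul_apply, smul_eq_mul, map_mul] at this
      exact (kerProj_eq_zero_iff hu).mp ((mul_eq_zero.mp this).resolve_right hi₀))
  refine hasExponents_of_basis b' fun j => ⟨fun h => b'.ne_zero j (Subtype.ext h), fun k => ?_⟩
  by_cases hj : j = i₀
  · subst hj
    rw [hb'₀, Function.update_self, add_comm]
    exact (linPoly_isHomogeneous f).mul ((hb j).2 k)
  · rw [hb' j hj, Function.update_of_ne hj]
    refine ((hb j).2 k).sub ?_
    change (C c⁻¹ * g j * (b i₀).1 (X k)).IsHomogeneous _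
    rw [mul_assoc]
    exact (hgh j _ ((hb i₀).2 k)).C_mul _

end Addition

end Arrgt

namespace Arrgt

section RankThree

open MvPolynomial

variable {K : Type*} [Field K] {n : ℕ}

lemma isHomogeneous_derivation_linPoly
    {θ : Derivation K (MvPolynomial (Fin n) K) (MvPolynomial (Fin n) K)} {d : ℕ}
    (hθ : ∀ i, (θ (X i)).IsHomogeneous d) (g : (Fin n → K) →ₗ[K] K) :
    (θ (linPoly g)).IsHomogeneous d := by
  rw [derivation_linPoly]
  exact IsHomogeneous.sum _ _ _ fun k _ => (hθ k).C_mul _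

lemma exists_single_ne_zero {f : (Fin n → K) →ₗ[K] K} (hf : f ≠ 0) :
    ∃ k, f (Pi.single k 1) ≠ 0 := by
  by_contra! h
  exact hf (LinearMap.ext fun x => by simp [apply_eq_sum f x, h])

lemma pderiv_linPoly (k : Fin n) (f : (Fin n → K) →ₗ[K] K) :
    pderiv k (linPoly f) = C (f (Pi.single k 1)) := by
  rw [derivation_linPoly, Finset.sum_eq_single k]
  · simp
  · intro i _ hi
    simp [pderiv_X, Ne.symm hi]
  · simp

lemma exists_basis_notMem {A : Arrangement K n} {f : (Fin n → K) →ₗ[K] K} (hf : f ≠ 0)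
    (hH : LinearMap.ker f ∈ A.hyperplanes)
    (b : Basis (Fin n) (MvPolynomial (Fin n) K) (logDer (A.delete (LinearMap.ker f)))) :
    ∃ i, (b i).1 ∉ logDer A := by
  by_contra! h
  obtain ⟨α, hα⟩ := (A.delete (LinearMap.ker f)).exists_forms
  obtain ⟨k, hk⟩ := exists_single_ne_zero hf
  set P := ∏ L ∈ (A.delete (LinearMap.ker f)).hyperplanes, linPoly (α L) with hP
  have hmem : P • pderiv k ∈ logDer (A.delete (LinearMap.ker f)) :=
    (mem_logDer_iff hα).mpr fun L hL => (Finset.dvd_prod_of_mem _ hL).mul_right _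
  have hmem' : P • pderiv k ∈ logDer A := by
    have h1 := congrArg Subtype.val (b.sum_repr ⟨_, hmem⟩)
    simp only [Submodule.coe_sum, Submodule.coe_smul] at h1
    rw [← h1]
    exact Submodule.sum_mem _ fun i _ => Submodule.smul_mem _ _ (h i)
  have hdvd := ((mem_logDer_iff_delete hf hH).mp hmem').2
  rw [Derivation.smul_apply, smul_eq_mul, pderiv_linPoly] at hdvd
  rcases (prime_linPoly hf).dvd_or_dvd hdvd with h1 | h1
  · obtain ⟨L, hL, h2⟩ := ((prime_linPoly hf).dvd_finsetProd_iff _).mp h1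
    have := ker_eq_of_linPoly_dvd hf (hα L hL).1 h2
    rw [(hα L hL).2] at this
    exact (Finset.mem_erase.mp hL).1 this.symm
  · exact (prime_linPoly hf).not_isUnit
      (isUnit_of_dvd_unit h1 ((isUnit_iff_ne_zero.mpr hk).map C))

lemma mul_comm_of_cross_eq_zero {R : Type*} [CommRing R] {P Q : Fin 3 → R}
    (h : ∀ k, (crossProduct P Q) k = 0) (i j : Fin 3) : P i * Q j = P j * Q i := by
  have h0 := h 0
  have h1 := h 1
  have h2 := h 2
  simp only [cross_apply, cons_val_zero, cons_val_one, cons_val] at h0 h1 h2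
  fin_cases i <;> fin_cases j <;> simp only [Fin.zero_eta, Fin.mk_one, Fin.reduceFinMk] <;>
    first
    | linear_combination h0
    | linear_combination h1
    | linear_combination h2
    | linear_combination -h0
    | linear_combination -h1
    | linear_combination -h2

lemma dvd_minor_mul_cross {R : Type*} [CommRing R] {v w P Q : Fin 3 → R} {ρ : R}
    (hvP : v ⬝ᵥ P = 0) (hvQ : v ⬝ᵥ Q = 0) (hwP : ρ ∣ w ⬝ᵥ P) (hwQ : ρ ∣ w ⬝ᵥ Q)
    (i j k : Fin 3) : ρ ∣ (v i * w j - v j * w i) * (crossProduct P Q) k := by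
  have hv : ∀ i j, v i * (crossProduct P Q) j - v j * (crossProduct P Q) i = 0 := by
    simp only [vec3_dotProduct] at hvP hvQ
    intro i j
    fin_cases i <;> fin_cases j <;> simp [cross_apply] <;>
      first
      | linear_combination P 0 * hvQ - Q 0 * hvP
      | linear_combination P 1 * hvQ - Q 1 * hvP
      | linear_combination P 2 * hvQ - Q 2 * hvP
      | linear_combination -P 0 * hvQ + Q 0 * hvP
      | linear_combination -P 1 * hvQ + Q 1 * hvP
      | linear_combination -P 2 * hvQ + Q 2 * hvP
  have hw : ∀ i j, ρ ∣ w i * (crossProduct P Q) j - w j * (crossProduct P Q) i := by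
    obtain ⟨s, hs⟩ := hwP
    obtain ⟨t, ht⟩ := hwQ
    simp only [vec3_dotProduct] at hs ht
    intro i j
    fin_cases i <;> fin_cases j <;> simp [cross_apply] <;>
      first
      | exact ⟨P 0 * t - Q 0 * s, by linear_combination P 0 * ht - Q 0 * hs⟩
      | exact ⟨P 1 * t - Q 1 * s, by linear_combination P 1 * ht - Q 1 * hs⟩
      | exact ⟨P 2 * t - Q 2 * s, by linear_combination P 2 * ht - Q 2 * hs⟩
      | exact ⟨-P 0 * t + Q 0 * s, by linear_combination -P 0 * ht + Q 0 * hs⟩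
      | exact ⟨-P 1 * t + Q 1 * s, by linear_combination -P 1 * ht + Q 1 * hs⟩
      | exact ⟨-P 2 * t + Q 2 * s, by linear_combination -P 2 * ht + Q 2 * hs⟩
  rw [show (v i * w j - v j * w i) * (crossProduct P Q) k =
      v i * (w j * (crossProduct P Q) k - w k * (crossProduct P Q) j) +
      w k * (v i * (crossProduct P Q) j - v j * (crossProduct P Q) i) +
      v j * (w k * (crossProduct P Q) i - w i * (crossProduct P Q) k) by ring, hv, mul_zero,
    add_zero]
  exact dvd_add ((hw j k).mul_left _) ((hw k i).mul_left _)

variable {f : (Fin n → K) →ₗ[K] K} {u : Fin n → K}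

lemma exists_minor_ne_zero (hu : f u = 1) {g : (Fin n → K) →ₗ[K] K}
    (hg : restrForm f g u ≠ 0) :
    ∃ i j, f (Pi.single i 1) * g (Pi.single j 1) - f (Pi.single j 1) * g (Pi.single i 1) ≠ 0 := by
  by_contra! h
  obtain ⟨k, hk⟩ := exists_single_ne_zero (f := f) (fun h => by simp [h] at hu)
  have key : ∀ x, f (Pi.single k 1) * g x = g (Pi.single k 1) * f x := fun x => by
    rw [apply_eq_sum g x, apply_eq_sum f x, Finset.mul_sum, Finset.mul_sum]
    exact Finset.sum_congr rfl fun i _ => by linear_combination x i * h k i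
  refine hg (LinearMap.ext fun x => mul_left_cancel₀ hk ?_)
  have h1 := key u
  have h2 := key x
  rw [hu] at h1
  simp only [restrForm, LinearMap.sub_apply, LinearMap.smul_apply, smul_eq_mul,
    LinearMap.zero_apply]
  linear_combination h2 - f x * h1

lemma kerProj_mul_comm_of_lt {A : Arrangement K 3} {f : (Fin 3 → K) →ₗ[K] K} {u : Fin 3 → K}
    (hu : f u = 1) (hH : LinearMap.ker f ∈ A.hyperplanes)
    {θ η : Derivation K (MvPolynomial (Fin 3) K) (MvPolynomial (Fin 3) K)}
    (hθ : θ ∈ logDer A) (hη : η ∈ logDer A) {p q : ℕ}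
    (hp : ∀ i, (θ (X i)).IsHomogeneous p) (hq : ∀ i, (η (X i)).IsHomogeneous q)
    (hpq : p + q < A.restrCard (LinearMap.ker f)) (i j : Fin 3) :
    kerProj f u (θ (X i)) * kerProj f u (η (X j)) =
      kerProj f u (θ (X j)) * kerProj f u (η (X i)) := by
  obtain ⟨α, hα⟩ := A.exists_forms
  set P : Fin 3 → MvPolynomial (Fin 3) K := fun i => kerProj f u (θ (X i)) with hP
  set Q : Fin 3 → MvPolynomial (Fin 3) K := fun i => kerProj f u (η (X i)) with hQ
  set co : ((Fin 3 → K) →ₗ[K] K) → Fin 3 → MvPolynomial (Fin 3) K :=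
    fun g i => C (g (Pi.single i 1)) with hco
  have hdot : ∀ (ζ : Derivation K (MvPolynomial (Fin 3) K) (MvPolynomial (Fin 3) K))
      (g : (Fin 3 → K) →ₗ[K] K), (co g ⬝ᵥ fun i => kerProj f u (ζ (X i))) =
        kerProj f u (ζ (linPoly g)) := fun ζ g => by
    simp [derivation_linPoly, dotProduct, co, algHom_C]
  have hzero : ∀ ζ ∈ logDer A, (co f ⬝ᵥ fun i => kerProj f u (ζ (X i))) = 0 := fun ζ hζ => by
    rw [hdot, kerProj_eq_zero_iff hu]
    exact hζ _ hH f rfl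
  have hα' : ∀ L ∈ A.hyperplanes.erase (LinearMap.ker f), restrForm f (α L) u ≠ 0 := fun L hL => by
    obtain ⟨hL1, hL2⟩ := Finset.mem_erase.mp hL
    exact restrForm_ne_zero (hα L hL2).1 (by rwa [(hα L hL2).2])
  have hdvd : ∀ L ∈ A.hyperplanes.erase (LinearMap.ker f), ∀ k,
      kerProj f u (linPoly (α L)) ∣ (crossProduct P Q) k := fun L hL k => by
    have hL2 := Finset.mem_of_mem_erase hL
    obtain ⟨i, j, hij⟩ := exists_minor_ne_zero hu (hα' L hL)
    have h1 := dvd_minor_mul_cross (hzero θ hθ) (hzero η hη) (w := co (α L))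
      (ρ := kerProj f u (linPoly (α L)))
      (by rw [hdot]; exact map_dvd _ (hθ L hL2 _ (hα L hL2).2))
      (by rw [hdot]; exact map_dvd _ (hη L hL2 _ (hα L hL2).2)) i j k
    simp only [hco, ← C_mul, ← C_sub] at h1
    exact ((isUnit_iff_ne_zero.mpr hij).map C).dvd_mul_left.mp h1
  set T := (A.hyperplanes.erase (LinearMap.ker f)).image fun L => L ⊓ LinearMap.ker f with hT
  have hrep : ∀ Y, ∃ L, Y ∈ T → L ∈ A.hyperplanes.erase (LinearMap.ker f) ∧
      L ⊓ LinearMap.ker f = Y := fun Y => by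
    by_cases hY : Y ∈ T
    · obtain ⟨L, hL⟩ := Finset.mem_image.mp hY
      exact ⟨L, fun _ => hL⟩
    · exact ⟨⊥, fun h => absurd h hY⟩
  choose rep hrep using hrep
  have hcross : ∀ k, (crossProduct P Q) k = 0 := fun k => by
    have hhom : ((crossProduct P Q) k).IsHomogeneous (p + q) := by
      have hP' := fun i => kerProj_isHomogeneous (f := f) (u := u) (hp i)
      have hQ' := fun i => kerProj_isHomogeneous (f := f) (u := u) (hq i)
      rw [cross_apply]
      fin_cases k <;> exact ((hP' _).mul (hQ' _)).sub ((hP' _).mul (hQ' _))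
    refine eq_zero_of_isHomogeneous_of_dvd (p := ∏ Y ∈ T, kerProj f u (linPoly (α (rep Y))))
      (a := ∑ Y ∈ T, 1)
      (IsHomogeneous.prod _ _ _ fun Y _ => kerProj_isHomogeneous (linPoly_isHomogeneous _)) hhom
      (by rw [Finset.sum_const, smul_eq_mul, mul_one]; exact hpq) ?_
    refine Finset.prod_dvd_of_isRelPrime (fun Y hY Z hZ hYZ => ?_)
      fun Y hY => hdvd _ (hrep Y hY).1 k
    refine isRelPrime_kerProj hu (hα' _ (hrep Y hY).1) (hα' _ (hrep Z hZ).1) ?_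
    rw [(hα _ (Finset.mem_of_mem_erase (hrep Y hY).1)).2, (hrep Y hY).2,
      (hα _ (Finset.mem_of_mem_erase (hrep Z hZ).1)).2, (hrep Z hZ).2]
    exact hYZ
  exact mul_comm_of_cross_eq_zero hcross i j

lemma exists_eq_smul_of_kerProj_eq_zero {A : Arrangement K n} (hu : f u = 1)
    {θ : Derivation K (MvPolynomial (Fin n) K) (MvPolynomial (Fin n) K)}
    (hθ : θ ∈ logDer (A.delete (LinearMap.ker f)))
    (h : ∀ j, kerProj f u (θ (X j)) = 0) :
    ∃ θ' ∈ logDer (A.delete (LinearMap.ker f)), θ = linPoly f • θ' := by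
  choose q hq using fun j => (kerProj_eq_zero_iff hu).mp (h j)
  have heq : θ = linPoly f • mkDerivation K q := derivation_ext fun j => by
    rw [hq, Derivation.smul_apply, mkDerivation_X, smul_eq_mul]
  refine ⟨_, ?_, heq⟩
  obtain ⟨α, hα⟩ := (A.delete (LinearMap.ker f)).exists_forms
  rw [mem_logDer_iff hα] at hθ ⊢
  intro L hL
  have h1 := hθ L hL
  rw [heq, Derivation.smul_apply, smul_eq_mul] at h1
  refine ((prime_linPoly (hα L hL).1).dvd_or_dvd h1).resolve_left fun h2 => ?_
  have := ker_eq_of_linPoly_dvd (hα L hL).1 (fun h => by simp [h] at hu) h2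
  rw [(hα L hL).2] at this
  exact (Finset.mem_erase.mp hL).1 this

lemma exists_kerProj_mul_ne {A : Arrangement K n} (hu : f u = 1)
    (b : Basis (Fin n) (MvPolynomial (Fin n) K) (logDer (A.delete (LinearMap.ker f))))
    {i₁ i₂ : Fin n} (hi : i₁ ≠ i₂) :
    ∃ i j, kerProj f u ((b i₁).1 (X i)) * kerProj f u ((b i₂).1 (X j)) ≠
      kerProj f u ((b i₁).1 (X j)) * kerProj f u ((b i₂).1 (X i)) := by
  by_contra! h
  have hP : ∀ i, kerProj f u ((b i₁).1 (X i)) = 0 := fun i => by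
    obtain ⟨ψ, hψ, hψe⟩ := exists_eq_smul_of_kerProj_eq_zero (A := A) hu
      (kerProj f u ((b i₂).1 (X i)) • b i₁ + (-kerProj f u ((b i₁).1 (X i))) • b i₂).2
      (fun j => by
        change kerProj f u (_ * (b i₁).1 (X j) + -_ * (b i₂).1 (X j)) = 0
        rw [map_add, map_mul, map_mul, map_neg, kerProj_kerProj hu, kerProj_kerProj hu]
        linear_combination -h i j)
    have h1 : kerProj f u ((b i₂).1 (X i)) • b i₁ + (-kerProj f u ((b i₁).1 (X i))) • b i₂ =
        linPoly f • (⟨ψ, hψ⟩ : logDer (A.delete (LinearMap.ker f))) := Subtype.ext hψe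
    have h2 := congrArg (fun x => b.repr x i₂) h1
    simp only [map_add, map_smul, Finsupp.add_apply, Finsupp.smul_apply, Basis.repr_self,
      Finsupp.single_eq_same, Finsupp.single_eq_of_ne (Ne.symm hi), smul_eq_mul, mul_zero,
      mul_one, zero_add] at h2
    have h3 : linPoly f ∣ kerProj f u ((b i₁).1 (X i)) := by
      rw [← dvd_neg, h2]
      exact dvd_mul_right _ _
    rw [← kerProj_kerProj hu]
    exact (kerProj_eq_zero_iff hu).mpr h3
  obtain ⟨θ, hθ, hθe⟩ := exists_eq_smul_of_kerProj_eq_zero (A := A) hu (b i₁).2 hP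
  have h1 : b i₁ = linPoly f • (⟨θ, hθ⟩ : logDer (A.delete (LinearMap.ker f))) :=
    Subtype.ext hθe
  have h2 := congrArg (fun x => b.repr x i₁) h1
  simp only [map_smul, Finsupp.smul_apply, Basis.repr_self, Finsupp.single_eq_same,
    smul_eq_mul] at h2
  exact (prime_linPoly (f := f) (fun h => by simp [h] at hu)).not_isUnit (.of_mul_eq_one _ h2.symm)

lemma apply_eq_zero_of_derivation_isHomogeneous_zero {A : Arrangement K n}
    {θ : Derivation K (MvPolynomial (Fin n) K) (MvPolynomial (Fin n) K)} (hθ : θ ∈ logDer A)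
    (h0 : ∀ i, (θ (X i)).IsHomogeneous 0)
    (hA : ∀ x, (∀ L ∈ A.hyperplanes, x ∈ L) → x = 0) : θ = 0 := by
  choose x hx using fun i =>
    (⟨_, totalDegree_eq_zero_iff_eq_C.mp ((totalDegree_zero_iff_isHomogeneous _).mpr (h0 i))⟩ :
      ∃ c, θ (X i) = C c)
  have hx0 : x = 0 := hA x fun L hL => by
    obtain ⟨g, -, rfl⟩ := A.isHyp L hL
    have h1 := eq_zero_of_isHomogeneous_of_dvd (linPoly_isHomogeneous g)
      (isHomogeneous_derivation_linPoly h0 g) one_pos (hθ _ hL g rfl)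
    rw [derivation_linPoly] at h1
    simp only [hx, ← C_mul, ← map_sum, ← apply_eq_sum] at h1
    exact C_eq_zero.mp h1
  exact derivation_ext fun i => by simp [hx, hx0]

/-- The addition theorem in rank three, with the hypothesis on the restriction replaced by the
number of its hyperplanes. -/
theorem HasExponents.add_of_restrCard {A : Arrangement K 3} {H : Submodule K (Fin 3 → K)}
    (hH : H ∈ A.hyperplanes) {c a m : ℕ} (h : HasExponents (A.delete H) {c, a, m})
    (hcard : (A.delete H).hyperplanes.card = c + a + m) (hr : A.restrCard H = c + a)
    (hm : c ≤ m ∨ (m = 0 ∧ ∀ x, (∀ L ∈ A.hyperplanes, x ∈ L) → x = 0)) :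
    HasExponents A {c, a, m + 1} := by
  obtain ⟨f, hf, rfl⟩ := A.isHyp H hH
  obtain ⟨u, hu⟩ := exists_apply_eq_one hf
  obtain ⟨b, hb⟩ := HasExponents.exists_basis (d := ![c, a, m]) h
  have hBdeg : (A.delete (LinearMap.ker f)).hyperplanes.card - A.restrCard (LinearMap.ker f) =
      m := by omega
  by_cases hcase : ∃ i, ![c, a, m] i = m ∧ kerProj f u ((b i).1 (linPoly f)) ≠ 0
  · obtain ⟨i, hi, hi0⟩ := hcase
    have key := exists_basis_of_kerProj_ne_zero hu hH b hb (hi.trans hBdeg.symm) hi0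
    rw [hi] at key
    convert key using 1
    fin_cases i
    · obtain rfl : c = m := hi
      change ({c, a, c + 1} : Multiset ℕ) = {c + 1, a, c}
      simp only [Multiset.insert_eq_cons, ← Multiset.cons_zero]
      rw [Multiset.cons_swap a, Multiset.cons_swap c, Multiset.cons_swap c a]
    · obtain rfl : a = m := hi
      change ({c, a, a + 1} : Multiset ℕ) = {c, a + 1, a}
      simp only [Multiset.insert_eq_cons, ← Multiset.cons_zero]
      rw [Multiset.cons_swap a]
    · rfl
  · push Not at hcase
    have hmem : ∀ i, ![c, a, m] i ≤ m → (b i).1 ∈ logDer A := fun i hi => by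
      refine (mem_logDer_iff_delete hf hH).mpr ⟨(b i).2, (kerProj_eq_zero_iff hu).mp ?_⟩
      rcases hi.eq_or_lt with hi | hi
      · exact hcase i hi
      · obtain ⟨B, -, -, hBh, hB⟩ := exists_dvd_kerProj (A := A) hu
        rw [hBdeg] at hBh
        exact eq_zero_of_isHomogeneous_of_dvd hBh
          (kerProj_isHomogeneous (isHomogeneous_derivation_linPoly (hb i).2 f)) hi
          (hB _ (b i).2)
    rcases hm with hcm | ⟨rfl, hA⟩
    · exfalso
      by_cases ham : a ≤ m
      · obtain ⟨i, hi⟩ := exists_basis_notMem hf hH b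
        refine hi (hmem i ?_)
        fin_cases i
        exacts [hcm, ham, le_rfl]
      · obtain ⟨i, j, hij⟩ := exists_kerProj_mul_ne hu b (i₁ := 0) (i₂ := 2) (by decide)
        exact hij (kerProj_mul_comm_of_lt hu hH (hmem 0 hcm) (hmem 2 le_rfl) (hb 0).2 (hb 2).2
          (by rw [hr]; change c + m < _; omega) i j)
    · exact absurd (apply_eq_zero_of_derivation_isHomogeneous_zero (hmem 2 le_rfl) (hb 2).2 hA)
        (hb 2).1

end RankThree

end Arrgt

namespace Arrgt

section LowRank

open MvPolynomial

variable {K : Type*} [Field K] {n : ℕ}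

lemma Arrangement.eq_emptyArr {A : Arrangement K n} (h : A.hyperplanes = ∅) :
    A = emptyArr K n := by
  cases A
  subst h
  rfl

lemma Arrangement.finrank_add_one (A : Arrangement K n) {H : Submodule K (Fin n → K)}
    (hH : H ∈ A.hyperplanes) : finrank K H + 1 = n := by
  obtain ⟨f, hf, rfl⟩ := A.isHyp H hH
  rw [Module.Dual.finrank_ker_add_one_of_ne_zero hf, finrank_fin_fun]

lemma Arrangement.not_le (A : Arrangement K n) {H L : Submodule K (Fin n → K)}
    (hH : H ∈ A.hyperplanes) (hL : L ∈ A.hyperplanes) (h : L ≠ H) : ¬ H ≤ L := fun hle =>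
  h (Submodule.eq_of_le_of_finrank_eq hle (by
    have := A.finrank_add_one hH
    have := A.finrank_add_one hL
    omega)).symm

lemma exists_isRestriction {A : Arrangement K (n + 1)} {H : Submodule K (Fin (n + 1) → K)}
    (hH : H ∈ A.hyperplanes) :
    ∃ B : Arrangement K n, IsRestriction A H B ∧ B.hyperplanes.card = A.restrCard H := by
  let e : H ≃ₗ[K] (Fin n → K) := LinearEquiv.ofFinrankEq _ _ (by
    rw [finrank_fin_fun]
    exact Nat.add_right_cancel (A.finrank_add_one hH))
  let φ : Submodule K (Fin (n + 1) → K) → Submodule K (Fin n → K) :=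
    fun L => Submodule.map (e : H →ₗ[K] (Fin n → K)) (L.comap H.subtype)
  refine ⟨⟨(A.hyperplanes.erase H).image φ, fun X hX => ?_⟩, ⟨e, rfl⟩, ?_⟩
  · obtain ⟨L, hL, rfl⟩ := Finset.mem_image.mp hX
    obtain ⟨hLH, hL⟩ := Finset.mem_erase.mp hL
    have hnot := A.not_le hH hL hLH
    obtain ⟨g, -, rfl⟩ := A.isHyp L hL
    refine ⟨g ∘ₗ H.subtype ∘ₗ e.symm.toLinearMap, fun h0 => hnot fun x hx => ?_, ?_⟩
    · simpa using LinearMap.congr_fun h0 (e ⟨x, hx⟩)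
    · ext x
      simp only [φ, Submodule.mem_map_equiv, Submodule.mem_comap, LinearMap.mem_ker]
      rfl
  · have hφ : (A.hyperplanes.erase H).image φ =
        ((A.hyperplanes.erase H).image fun L => L ⊓ H).image φ := by
      rw [Finset.image_image]
      refine Finset.image_congr fun L _ => ?_
      simp [φ, Submodule.comap_inf]
    change ((A.hyperplanes.erase H).image φ).card = _
    rw [hφ, Finset.card_image_of_injOn]
    · rfl
    · intro X hX Y hY hXY
      obtain ⟨L, -, rfl⟩ := Finset.mem_image.mp hX
      obtain ⟨M, -, rfl⟩ := Finset.mem_image.mp hY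
      have h1 := congrArg (Submodule.map H.subtype) (Submodule.map_injective_of_injective
        e.injective hXY)
      simpa only [Submodule.map_comap_subtype, inf_comm H, inf_assoc, inf_idem] using h1

lemma restrCard_of_delete_eq_empty {A : Arrangement K n} {H : Submodule K (Fin n → K)}
    (h : (A.delete H).hyperplanes = ∅) : A.restrCard H = 0 := by
  change ((A.delete H).hyperplanes.image _).card = 0
  rw [h, Finset.image_empty, Finset.card_empty]

lemma hasExponents_emptyArr :
    HasExponents (emptyArr K n) (Finset.univ.val.map fun _ : Fin n => 0) := by
  have hmem : ∀ θ, θ ∈ logDer (emptyArr K n) := fun θ H hH => absurd hH (Finset.notMem_empty H)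
  let e : logDer (emptyArr K n) ≃ₗ[MvPolynomial (Fin n) K] (Fin n → MvPolynomial (Fin n) K) :=
    { toFun := fun θ j => θ.1 (X j)
      map_add' := fun _ _ => rfl
      map_smul' := fun _ _ => rfl
      invFun := fun q => ⟨mkDerivation K q, hmem _⟩
      left_inv := fun θ => Subtype.ext (derivation_ext fun j => mkDerivation_X _ _ j)
      right_inv := fun q => funext fun j => mkDerivation_X _ _ j }
  refine hasExponents_of_basis (Basis.ofEquivFun e) fun i => ?_
  have hX : ∀ k, ((Basis.ofEquivFun e) i).1 (X k) =
      (Pi.single i 1 : Fin n → MvPolynomial (Fin n) K) k := fun k => by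
    rw [Basis.coe_ofEquivFun]
    exact mkDerivation_X _ _ k
  refine ⟨fun h => ?_, fun k => ?_⟩
  · have := hX i
    rw [h, Pi.single_eq_same] at this
    exact zero_ne_one this
  · rw [hX, Pi.single_apply]
    split_ifs
    · exact isHomogeneous_one _ _
    · exact isHomogeneous_zero _ _ _

lemma exists_basis_kerProj_ne_zero {A : Arrangement K n} {f : (Fin n → K) →ₗ[K] K}
    {u : Fin n → K} (hu : f u = 1) (hH : LinearMap.ker f ∈ A.hyperplanes) {d : Fin n → ℕ}
    (b : Basis (Fin n) (MvPolynomial (Fin n) K) (logDer (A.delete (LinearMap.ker f))))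
    (hb : ∀ i, IsHomogeneousDer (b i).1 (d i)) :
    ∃ i, kerProj f u ((b i).1 (linPoly f)) ≠ 0 ∧
      (A.delete (LinearMap.ker f)).hyperplanes.card - A.restrCard (LinearMap.ker f) ≤ d i := by
  have hf : f ≠ 0 := fun h => by simp [h] at hu
  obtain ⟨i, hi⟩ := exists_basis_notMem hf hH b
  have hi0 : kerProj f u ((b i).1 (linPoly f)) ≠ 0 := fun h0 =>
    hi ((mem_logDer_iff_delete hf hH).mpr ⟨(b i).2, (kerProj_eq_zero_iff hu).mp h0⟩)
  refine ⟨i, hi0, not_lt.mp fun hlt => hi0 ?_⟩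
  obtain ⟨B, -, -, hBh, hB⟩ := exists_dvd_kerProj (A := A) hu
  exact eq_zero_of_isHomogeneous_of_dvd hBh
    (kerProj_isHomogeneous (isHomogeneous_derivation_linPoly (hb i).2 f)) hlt (hB _ (b i).2)

lemma Arrangement.hyperplanes_of_rank_zero (A : Arrangement K 0) : A.hyperplanes = ∅ :=
  Finset.eq_empty_of_forall_notMem fun _ hH => absurd (A.finrank_add_one hH) (Nat.succ_ne_zero _)

lemma Arrangement.card_le_one (A : Arrangement K 1) : A.hyperplanes.card ≤ 1 :=
  Finset.card_le_one.mpr fun H hH L hL => by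
    rw [Submodule.finrank_eq_zero.mp (Nat.succ.inj (A.finrank_add_one hH)),
      Submodule.finrank_eq_zero.mp (Nat.succ.inj (A.finrank_add_one hL))]

theorem inductivelyFree_and_hasExponents_rank_one (A : Arrangement K 1) :
    InductivelyFree K A ∧ HasExponents A {A.hyperplanes.card} := by
  by_cases hA : A.hyperplanes = ∅
  · rw [A.eq_emptyArr hA]
    exact ⟨.empty 1, hasExponents_emptyArr⟩
  · obtain ⟨H, hH⟩ := Finset.nonempty_iff_ne_empty.mpr hA
    have hcard : A.hyperplanes.card = 1 :=
      le_antisymm A.card_le_one (Finset.card_pos.mpr ⟨H, hH⟩)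
    have hdel : (A.delete H).hyperplanes = ∅ := Finset.card_eq_zero.mp (by
      change (A.hyperplanes.erase H).card = 0
      rw [Finset.card_erase_of_mem hH, hcard])
    have hr := restrCard_of_delete_eq_empty hdel
    obtain ⟨B, hB, -⟩ := exists_isRestriction hH
    have hexp : HasExponents (A.delete H) (Finset.univ.val.map fun _ : Fin 1 => 0) := by
      rw [(A.delete H).eq_emptyArr hdel]
      exact hasExponents_emptyArr
    refine ⟨.add A H hH B hB {0} 0 ?_ ?_ hexp ?_ (Multiset.zero_le _), ?_⟩
    · rw [(A.delete H).eq_emptyArr hdel]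
      exact .empty 1
    · rw [B.eq_emptyArr B.hyperplanes_of_rank_zero]
      exact .empty 0
    · rw [B.eq_emptyArr B.hyperplanes_of_rank_zero]
      exact hasExponents_emptyArr
    · obtain ⟨f, hf, rfl⟩ := A.isHyp H hH
      obtain ⟨u, hu⟩ := exists_apply_eq_one hf
      obtain ⟨b, hb⟩ := hexp.exists_basis
      obtain ⟨i, hi, -⟩ := exists_basis_kerProj_ne_zero hu hH b hb
      have key := exists_basis_of_kerProj_ne_zero hu hH b hb (i₀ := i) (by simp [hdel]) hi
      rw [hcard]
      convert key using 1
      fin_cases i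
      rfl

/-- The exponents of an arrangement of `m` lines through the origin of a plane. -/
def rankTwoExponents (m : ℕ) : Multiset ℕ := if m = 0 then {0, 0} else {1, m - 1}

lemma restrCard_rank_two {A : Arrangement K 2} {H : Submodule K (Fin 2 → K)}
    (hH : H ∈ A.hyperplanes) (h : 0 < (A.delete H).hyperplanes.card) : A.restrCard H = 1 := by
  obtain ⟨B, -, hB⟩ := exists_isRestriction hH
  refine le_antisymm (hB ▸ B.card_le_one) (Finset.card_pos.mpr ?_)
  exact (Finset.card_pos.mp h).image _

theorem hasExponents_rank_two_add {A : Arrangement K 2} {H : Submodule K (Fin 2 → K)}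
    (hH : H ∈ A.hyperplanes)
    (h : HasExponents (A.delete H) (rankTwoExponents (A.delete H).hyperplanes.card)) :
    HasExponents A (rankTwoExponents A.hyperplanes.card) := by
  have hcard : A.hyperplanes.card = (A.delete H).hyperplanes.card + 1 :=
    (Finset.card_erase_add_one hH).symm
  obtain ⟨f, hf, rfl⟩ := A.isHyp H hH
  obtain ⟨u, hu⟩ := exists_apply_eq_one hf
  rw [hcard, rankTwoExponents, if_neg (Nat.succ_ne_zero _), Nat.add_sub_cancel]
  rcases Nat.eq_zero_or_pos (A.delete (LinearMap.ker f)).hyperplanes.card with h0 | hpos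
  · rw [h0, rankTwoExponents, if_pos rfl] at h
    obtain ⟨b, hb⟩ := HasExponents.exists_basis (d := ![0, 0]) h
    obtain ⟨i, hi, -⟩ := exists_basis_kerProj_ne_zero hu hH b hb
    have key := exists_basis_of_kerProj_ne_zero hu hH b hb (i₀ := i)
      (by rw [h0, Nat.zero_sub]; fin_cases i <;> rfl) hi
    rw [h0]
    convert key using 1
    fin_cases i
    · rfl
    · exact Multiset.pair_comm _ _
  · have hr := restrCard_rank_two hH hpos
    generalize hm : (A.delete (LinearMap.ker f)).hyperplanes.card = m at *
    rw [rankTwoExponents, if_neg hpos.ne'] at h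
    obtain ⟨b, hb⟩ := HasExponents.exists_basis (d := ![1, m - 1]) h
    by_cases h1 : kerProj f u ((b 1).1 (linPoly f)) = 0
    · obtain ⟨i, hi, hle⟩ := exists_basis_kerProj_ne_zero hu hH b hb
      obtain rfl : i = 0 := by
        fin_cases i
        · rfl
        · exact absurd h1 hi
      rw [hm, hr] at hle
      change m - 1 ≤ 1 at hle
      obtain rfl | rfl : m = 1 ∨ m = 2 := by omega
      · refine absurd (apply_eq_zero_of_derivation_isHomogeneous_zero
          ((mem_logDer_iff_delete hf hH).mpr ⟨(b 1).2, (kerProj_eq_zero_iff hu).mp h1⟩)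
          (hb 1).2 fun x hx => ?_) (hb 1).1
        obtain ⟨L, hL⟩ := Finset.card_pos.mp (hm.symm ▸ hpos)
        obtain ⟨hLH, hL⟩ := Finset.mem_erase.mp hL
        have hlt := Submodule.finrank_lt_finrank_of_lt
          (inf_le_left.lt_of_not_ge fun h => A.not_le hH hL hLH (h.trans inf_le_right))
        have hbot : LinearMap.ker f ⊓ L = ⊥ := Submodule.finrank_eq_zero.mp (by
          have := A.finrank_add_one hH
          omega)
        have : x ∈ LinearMap.ker f ⊓ L := ⟨hx _ hH, hx _ hL⟩
        rwa [hbot] at this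
      · have key := exists_basis_of_kerProj_ne_zero hu hH b hb (i₀ := 0)
          (by rw [hm, hr]; rfl) hi
        convert key using 1
        exact Multiset.pair_comm _ _
    · have key := exists_basis_of_kerProj_ne_zero hu hH b hb (i₀ := 1)
        (by rw [hm, hr]; rfl) h1
      convert key using 1
      change ({1, m} : Multiset ℕ) = {1, m - 1 + 1}
      rw [Nat.sub_add_cancel hpos]

theorem inductivelyFree_and_hasExponents_rank_two (A : Arrangement K 2) :
    InductivelyFree K A ∧ HasExponents A (rankTwoExponents A.hyperplanes.card) := by
  generalize hm : A.hyperplanes.card = m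
  induction m generalizing A with
  | zero =>
    rw [A.eq_emptyArr (Finset.card_eq_zero.mp hm)]
    exact ⟨.empty 2, hasExponents_emptyArr⟩
  | succ m ih =>
    obtain ⟨H, hH⟩ := Finset.card_pos.mp (by rw [hm]; exact Nat.succ_pos m)
    have hdel : (A.delete H).hyperplanes.card = m := by
      change (A.hyperplanes.erase H).card = m
      rw [Finset.card_erase_of_mem hH, hm, Nat.add_sub_cancel]
    obtain ⟨hfree, hexp⟩ := ih _ hdel
    obtain ⟨B, hB, hBcard⟩ := exists_isRestriction hH
    obtain ⟨hBfree, hBexp⟩ := inductivelyFree_and_hasExponents_rank_one B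
    refine ⟨.add A H hH B hB _ _ hfree hBfree hexp hBexp ?_, ?_⟩
    · rw [Multiset.singleton_le, hBcard]
      rcases Nat.eq_zero_or_pos m with rfl | hpos
      · rw [restrCard_of_delete_eq_empty (Finset.card_eq_zero.mp hdel)]
        simp [rankTwoExponents]
      · rw [restrCard_rank_two hH (hdel.symm ▸ hpos)]
        simp [rankTwoExponents, hpos.ne']
    · rw [← hm]
      exact hasExponents_rank_two_add hH (hdel.symm ▸ hexp)

end LowRank

end Arrgt

namespace Arrgt

section Chains

variable {K : Type*} [Field K]

/-- `A` is inductively free with exponents `{c, a, m}`, and these sum to its cardinality. -/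
structure InductivelyFreeWith (A : Arrangement K 3) (c a m : ℕ) : Prop where
  free : InductivelyFree K A
  exp : HasExponents A {c, a, m}
  card : A.hyperplanes.card = c + a + m

lemma InductivelyFreeWith.swap {A : Arrangement K 3} {c a m : ℕ}
    (h : InductivelyFreeWith A c a m) : InductivelyFreeWith A c m a where
  free := h.free
  exp := by
    have := h.exp
    rwa [Multiset.insert_eq_cons, Multiset.pair_comm, ← Multiset.insert_eq_cons] at this
  card := by rw [h.card]; omega

lemma InductivelyFreeWith.rotate {A : Arrangement K 3} {c a m : ℕ}
    (h : InductivelyFreeWith A c a m) : InductivelyFreeWith A a m c where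
  free := h.free
  exp := by
    have := h.exp
    simp only [Multiset.insert_eq_cons, ← Multiset.cons_zero] at this ⊢
    rwa [Multiset.cons_swap m, Multiset.cons_swap a]
  card := by rw [h.card]; omega

lemma InductivelyFreeWith.add {A : Arrangement K 3} {H : Submodule K (Fin 3 → K)}
    (hH : H ∈ A.hyperplanes) {c a m : ℕ} (h : InductivelyFreeWith (A.delete H) c a m)
    (hr : A.restrCard H = c + a) (hca : rankTwoExponents (c + a) = {c, a})
    (hm : c ≤ m ∨ (m = 0 ∧ ∀ x, (∀ L ∈ A.hyperplanes, x ∈ L) → x = 0)) :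
    InductivelyFreeWith A c a (m + 1) := by
  obtain ⟨B, hB, hBcard⟩ := exists_isRestriction hH
  obtain ⟨hBfree, hBexp⟩ := inductivelyFree_and_hasExponents_rank_two B
  rw [hBcard, hr, hca] at hBexp
  refine ⟨.add A H hH B hB _ _ h.free hBfree h.exp hBexp ?_,
    h.exp.add_of_restrCard hH h.card hr hm, ?_⟩
  · simp only [Multiset.insert_eq_cons, ← Multiset.cons_zero]
    exact Multiset.cons_le_cons _ (Multiset.cons_le_cons _ (Multiset.zero_le _))
  · rw [← Finset.card_erase_add_one hH, ← add_assoc, ← h.card]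
    rfl

lemma mem_perp {n : ℕ} {v x : Fin n → K} : x ∈ perp v ↔ v ⬝ᵥ x = 0 := by
  simp [perp, lf, dotProduct]

lemma perp_ne_of_cross_ne_zero {v w : Fin 3 → K} (h : crossProduct v w ≠ 0) :
    perp v ≠ perp w := by
  intro hvw
  have hv : v ≠ 0 := fun h0 => h (by rw [h0, map_zero, LinearMap.zero_apply])
  obtain ⟨c, -, hc⟩ := exists_eq_smul_of_ker_eq (lf_ne_zero hv) hvw
  have : w = c • v := funext fun i => by
    rw [← lf_single w, hc, LinearMap.smul_apply, lf_single, Pi.smul_apply]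
  rw [this, map_smul, cross_self, smul_zero] at h
  exact h rfl

lemma exists_eq_smul_cross {v w x : Fin 3 → K} (h : crossProduct v w ≠ 0) (hv : x ∈ perp v)
    (hw : x ∈ perp w) : ∃ t : K, x = t • crossProduct v w := by
  rw [mem_perp, dotProduct_comm] at hv hw
  obtain ⟨i, hi⟩ := Function.ne_iff.mp h
  have key : crossProduct x (crossProduct v w) = 0 := by
    rw [cross_cross_eq_smul_sub_smul', hw, dotProduct_comm v, hv, zero_smul, zero_smul, sub_zero]
  refine ⟨x i / crossProduct v w i, funext fun j => ?_⟩
  rw [Pi.smul_apply, smul_eq_mul, div_mul_eq_mul_div, eq_div_iff hi]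
  exact mul_comm_of_cross_eq_zero (fun k => congrFun key k) j i

lemma perp_inf_perp_eq_iff {v w w' : Fin 3 → K} (h : crossProduct v w ≠ 0)
    (h' : crossProduct v w' ≠ 0) :
    perp w ⊓ perp v = perp w' ⊓ perp v ↔ crossProduct v w ⬝ᵥ w' = 0 := by
  have hle : ∀ {w w'}, crossProduct v w ≠ 0 → crossProduct v w ⬝ᵥ w' = 0 →
      perp w ⊓ perp v ≤ perp w' ⊓ perp v := fun h h0 x hx => by
    obtain ⟨t, rfl⟩ := exists_eq_smul_cross h hx.2 hx.1
    refine ⟨mem_perp.mpr ?_, hx.2⟩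
    rw [dotProduct_smul, dotProduct_comm, h0, smul_zero]
  refine ⟨fun heq => ?_, fun h0 => le_antisymm (hle h h0) (hle h' ?_)⟩
  · have : crossProduct v w ∈ perp w ⊓ perp v :=
      ⟨mem_perp.mpr (dot_cross_self _ _), mem_perp.mpr (dot_self_cross _ _)⟩
    rw [heq] at this
    rw [dotProduct_comm]
    exact mem_perp.mp this.1
  · rw [dotProduct_comm, triple_product_permutation, triple_product_permutation, ← cross_anticomm,
      dotProduct_neg, dotProduct_comm, h0, neg_zero]

variable [DecidableEq K]

/-- Representatives of the classes of `L` modulo having the same restriction to `perp v`. -/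
def restrReps (v : Fin 3 → K) (L : List (Fin 3 → K)) : List (Fin 3 → K) :=
  L.foldr (fun w R => if ∀ r ∈ R, crossProduct v w ⬝ᵥ r ≠ 0 then w :: R else R) []

lemma card_eq_length_restrReps {v : Fin 3 → K} {L : List (Fin 3 → K)}
    (hL : ∀ w ∈ L, crossProduct v w ≠ 0) :
    ((L.map fun w => perp w ⊓ perp v).toFinset).card = (restrReps v L).length := by
  have key : (restrReps v L ⊆ L) ∧ ((restrReps v L).map fun w => perp w ⊓ perp v).Nodup ∧
      ∀ X, X ∈ (restrReps v L).map (fun w => perp w ⊓ perp v) ↔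
        X ∈ L.map fun w => perp w ⊓ perp v := by
    induction L with
    | nil => simp [restrReps]
    | cons w L ih =>
      obtain ⟨hsub, hnodup, hmem⟩ := ih fun x hx => hL x (List.mem_cons_of_mem _ hx)
      have hiff : (∀ r ∈ restrReps v L, crossProduct v w ⬝ᵥ r ≠ 0) ↔
          perp w ⊓ perp v ∉ (restrReps v L).map fun w => perp w ⊓ perp v := by
        simp only [List.mem_map, not_exists, not_and]
        refine forall₂_congr fun r hr => not_congr ?_
        rw [← perp_inf_perp_eq_iff (hL w List.mem_cons_self)
          (hL r (List.mem_cons_of_mem _ (hsub hr))), eq_comm]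
      have hstep : restrReps v (w :: L) = if ∀ r ∈ restrReps v L, crossProduct v w ⬝ᵥ r ≠ 0
          then w :: restrReps v L else restrReps v L := rfl
      rw [hstep]
      split_ifs with h
      · refine ⟨List.cons_subset_cons _ hsub, ?_, fun X => ?_⟩
        · rw [List.map_cons, List.nodup_cons]
          exact ⟨hiff.mp h, hnodup⟩
        · rw [List.map_cons, List.map_cons, List.mem_cons, List.mem_cons, hmem]
      · refine ⟨fun _ hr => List.mem_cons_of_mem _ (hsub hr), hnodup, fun X => ?_⟩
        rw [List.map_cons, List.mem_cons, hmem]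
        refine ⟨Or.inr, ?_⟩
        rintro (rfl | hX)
        · exact (hmem _).mp (not_not.mp (mt hiff.mpr h))
        · exact hX
  rw [← List.length_map (fun w => perp w ⊓ perp v), ← List.toFinset_card_of_nodup key.2.1]
  congr 1
  ext X
  rw [List.mem_toFinset, List.mem_toFinset, key.2.2]

lemma InductivelyFreeWith.cons {v : Fin 3 → K} {L : List (Fin 3 → K)} {c a m : ℕ}
    (ih : ∀ A : Arrangement K 3, A.hyperplanes = (L.map perp).toFinset →
      InductivelyFreeWith A c a m)
    (hL : ∀ w ∈ L, crossProduct v w ≠ 0) (hr : (restrReps v L).length = c + a)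
    (hca : rankTwoExponents (c + a) = {c, a})
    (hm : c ≤ m ∨ (m = 0 ∧ ∀ x, (∀ w ∈ v :: L, x ∈ perp w) → x = 0))
    (A : Arrangement K 3) (hA : A.hyperplanes = ((v :: L).map perp).toFinset) :
    InductivelyFreeWith A c a (m + 1) := by
  have hH : perp v ∈ A.hyperplanes := by simp [hA]
  have hdel : A.hyperplanes.erase (perp v) = (L.map perp).toFinset := by
    rw [hA, List.map_cons, List.toFinset_cons, Finset.erase_insert]
    simp only [List.mem_toFinset, List.mem_map, not_exists, not_and]
    exact fun w hw => (perp_ne_of_cross_ne_zero (hL w hw)).symm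
  refine (ih (A.delete (perp v)) hdel).add hH ?_ hca
    (hm.imp_right fun h => ⟨h.1, fun x hx => h.2 x fun w hw => hx _ ?_⟩)
  · rw [← hr, ← card_eq_length_restrReps hL, Arrangement.restrCard, hdel]
    congr 1
    ext X
    simp
  · rw [hA, List.mem_toFinset]
    exact List.mem_map_of_mem hw

/-- Whether prepending the entries of `L` one by one, last entry first, to the list `T` takes an
arrangement with exponents `{1, 1, 1}` to one with exponents `{1, a, m}`. -/
def isChain (T : List (Fin 3 → K)) : List (Fin 3 → K) → ℕ → ℕ → Bool
  | [], a, m => a == 1 && m == 1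
  | v :: L, a, m =>
    (L ++ T).all (fun w => crossProduct v w ≠ 0) &&
      ((restrReps v (L ++ T)).length == 1 + a && (m != 0 && isChain T L a (m - 1)) ||
        (restrReps v (L ++ T)).length == 1 + m && (a != 0 && isChain T L (a - 1) m))

lemma isChain_pos {T L : List (Fin 3 → K)} {a m : ℕ} (h : isChain T L a m) : 1 ≤ a ∧ 1 ≤ m := by
  induction L generalizing a m with
  | nil =>
    simp only [isChain, Bool.and_eq_true, beq_iff_eq] at h
    omega
  | cons v L ih =>
    simp only [isChain, Bool.and_eq_true, Bool.or_eq_true] at h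
    rcases h.2 with h | h <;> have := ih h.2.2 <;> omega

lemma rankTwoExponents_one_add (a : ℕ) : rankTwoExponents (1 + a) = {1, a} := by
  simp [rankTwoExponents]

lemma InductivelyFreeWith.of_isChain {T L : List (Fin 3 → K)} {a m : ℕ}
    (hT : ∀ A : Arrangement K 3, A.hyperplanes = (T.map perp).toFinset →
      InductivelyFreeWith A 1 1 1) (h : isChain T L a m)
    (A : Arrangement K 3) (hA : A.hyperplanes = ((L ++ T).map perp).toFinset) :
    InductivelyFreeWith A 1 a m := by
  induction L generalizing a m A with
  | nil =>
    simp only [isChain, Bool.and_eq_true, beq_iff_eq] at h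
    rw [h.1, h.2]
    exact hT A hA
  | cons v L ih =>
    simp only [isChain, Bool.and_eq_true, Bool.or_eq_true, List.all_eq_true, decide_eq_true_eq,
      beq_iff_eq, bne_iff_ne] at h
    obtain ⟨hL, ⟨hr, h0, h⟩ | ⟨hr, h0, h⟩⟩ := h
    · have := cons (ih h) hL hr (rankTwoExponents_one_add a) (.inl (isChain_pos h).2) A hA
      rwa [Nat.sub_add_cancel (Nat.pos_of_ne_zero h0)] at this
    · have := cons (fun A hA => (ih h A hA).swap) hL hr (rankTwoExponents_one_add m)
        (.inl (isChain_pos h).1) A hA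
      rw [Nat.sub_add_cancel (Nat.pos_of_ne_zero h0)] at this
      exact this.swap

lemma InductivelyFreeWith.of_triple {x y z : Fin 3 → K} (hxy : crossProduct x y ≠ 0)
    (hxz : crossProduct x z ≠ 0) (hyz : crossProduct y z ≠ 0)
    (h : crossProduct x y ⬝ᵥ z ≠ 0) (A : Arrangement K 3)
    (hA : A.hyperplanes = ([x, y, z].map perp).toFinset) : InductivelyFreeWith A 1 1 1 := by
  have h0 : ∀ A : Arrangement K 3, A.hyperplanes = (([] : List (Fin 3 → K)).map perp).toFinset →
      InductivelyFreeWith A 0 0 0 := fun A hA => by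
    rw [A.eq_emptyArr hA]
    exact ⟨.empty 3, hasExponents_emptyArr, rfl⟩
  have h1 := cons (v := z) h0 (by simp) rfl rfl (.inl le_rfl)
  have h2 := cons (v := y) (fun A hA => (h1 A hA).swap) (by simpa using hyz) rfl
    (Multiset.pair_comm _ _) (.inl le_rfl)
  refine cons (fun A hA => (h2 A hA).rotate) (by simp [hxy, hxz]) ?_ rfl
    (.inr ⟨rfl, fun u hu => ?_⟩) A hA
  · simp [restrReps, h]
  · obtain ⟨t, rfl⟩ := exists_eq_smul_cross hxy (hu x (by simp)) (hu y (by simp))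
    have hz := mem_perp.mp (hu z (by simp))
    rw [dotProduct_smul, dotProduct_comm, smul_eq_mul] at hz
    rw [(mul_eq_zero.mp hz).resolve_right h, zero_smul]

end Chains

/-- The normal vectors of `B₇` outside `baseVecs`, the last one to be added coming first. -/
def chainVecs : List (Fin 3 → ZMod 11) :=
  [![1,9,9], ![1,4,3], ![1,3,10], ![1,9,4], ![1,5,7], ![0,1,5], ![1,0,1],
   ![1,9,1], ![1,8,8], ![1,10,5], ![0,0,1], ![1,6,6], ![1,9,5], ![0,1,2],
   ![0,1,3], ![1,8,5], ![0,1,1], ![0,1,4], ![1,3,1], ![0,1,6], ![1,9,8],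
   ![1,2,0], ![1,1,0], ![1,2,2], ![1,4,4], ![1,3,0], ![1,10,0], ![1,0,0],
   ![1,4,0], ![0,1,0], ![1,7,0]]

/-- The normal vectors of a generic subarrangement of `B₇`. -/
def baseVecs : List (Fin 3 → ZMod 11) := [![1,5,0], ![1,9,0], ![1,6,4]]

lemma isChain_chainVecs : isChain baseVecs chainVecs 11 22 = true := by
  decide +kernel

lemma toFinset_chainVecs_append : (chainVecs ++ baseVecs).toFinset = (Bvecs ++ Hvecs).toFinset := by
  decide +kernel

end Arrgt

/-- The arrangement `B₇ = B ∪ {H₁, …, H₇}` in `𝔽₁₁³` is inductively free. -/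
theorem B7_inductivelyFree :
    InductivelyFree (ZMod 11) (mkArr (Bvecs ++ Hvecs).toFinset (by decide)) := by
  refine (InductivelyFreeWith.of_isChain
    (InductivelyFreeWith.of_triple (by decide) (by decide) (by decide) (by decide))
    isChain_chainVecs _ ?_).free
  change (Bvecs ++ Hvecs).toFinset.image perp = _
  rw [← toFinset_chainVecs_append]
  ext X
  simp only [Finset.mem_image, List.mem_toFinset, List.mem_map]
  rfl
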